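/- arXiv:2111.04002 — 9 statements merged into one kernel-verified Lean document; each statement's English description precedes it below -/
import Mathlib

section
/- Let W_p = p·Γ[|φ⁺⟩⟨φ⁺|] + (1−p)·I/4 on ℂ²⊗ℂ². For every p with 0 ≤ p ≤ 1, W_p is a POPT state: W_p is Hermitian with unit trace, and for all positive semidefinite 2×2 complex matrices A and B, the trace Tr[W_p (A ⊗ B)] is a nonnegative real number. -/
open Matrix Kronecker ComplexOrder

/-- The maximally entangled vector |φ⁺⟩ = (|00⟩+|11⟩)/√2 on ℂ²⊗ℂ². -/
noncomputable def phiPlus : Fin 2 × Fin 2 → ℂ :=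
  fun x => if x.1 = x.2 then (((Real.sqrt 2)⁻¹ : ℝ) : ℂ) else 0

/-- The projector |φ⁺⟩⟨φ⁺|. -/
noncomputable def phiPlusProj : Matrix (Fin 2 × Fin 2) (Fin 2 × Fin 2) ℂ :=
  Matrix.of fun x y => phiPlus x * (starRingEnd ℂ) (phiPlus y)

/-- The partial transpose (on the second factor) of |φ⁺⟩⟨φ⁺|. -/
noncomputable def phiPlusPT : Matrix (Fin 2 × Fin 2) (Fin 2 × Fin 2) ℂ :=
  Matrix.of fun x y => phiPlusProj (x.1, y.2) (y.1, x.2)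

/-- The family W_p = p·Γ[|φ⁺⟩⟨φ⁺|] + (1−p)·I/4. -/
noncomputable def Wp (p : ℝ) : Matrix (Fin 2 × Fin 2) (Fin 2 × Fin 2) ℂ :=
  (p : ℂ) • phiPlusPT + (((1 - p : ℝ) : ℂ) / 4) • (1 : Matrix (Fin 2 × Fin 2) (Fin 2 × Fin 2) ℂ)

lemma phiPT_apply (x y : Fin 2 × Fin 2) :
    phiPlusPT x y = if x.1 = y.2 ∧ y.1 = x.2 then (1/2 : ℂ) else 0 := by
  have h : (((Real.sqrt 2)⁻¹ : ℝ) : ℂ) * (((Real.sqrt 2)⁻¹ : ℝ) : ℂ) = 1/2 := by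
    rw [← Complex.ofReal_mul, ← mul_inv, Real.mul_self_sqrt (by norm_num)]
    norm_num
  simp only [phiPlusPT, phiPlusProj, phiPlus, Matrix.of_apply]
  by_cases h1 : x.1 = y.2 <;> by_cases h2 : y.1 = x.2 <;>
    simp only [h1, h2, if_true, if_false, Complex.conj_ofReal, h, map_zero, mul_zero, zero_mul,
      and_self, and_false, false_and]

open scoped MatrixOrder Matrix.Norms.L2Operator in
lemma trace_mul_nonneg_aux (A B : Matrix (Fin 2) (Fin 2) ℂ) (hA : A.PosSemidef)
    (hB : B.PosSemidef) : 0 ≤ (A * B).trace := by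
  obtain ⟨C, rfl⟩ : ∃ C : Matrix (Fin 2) (Fin 2) ℂ, B = Cᴴ * C :=
    CStarAlgebra.nonneg_iff_eq_star_mul_self.mp (Matrix.nonneg_iff_posSemidef.mpr hB)
  rw [← Matrix.mul_assoc, Matrix.trace_mul_comm, ← Matrix.mul_assoc]
  exact (hA.mul_mul_conjTranspose_same C).trace_nonneg

theorem stmt1 (p : ℝ) (hp0 : 0 ≤ p) (hp1 : p ≤ 1) :
    (Wp p).IsHermitian ∧ (Wp p).trace = 1 ∧
    ∀ (A B : Matrix (Fin 2) (Fin 2) ℂ), A.PosSemidef → B.PosSemidef →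
      0 ≤ ((Wp p * (A ⊗ₖ B)).trace).re ∧ ((Wp p * (A ⊗ₖ B)).trace).im = 0 := by
  refine ⟨?_, ?_, ?_⟩
  · ext ⟨a, b⟩ ⟨c, d⟩
    fin_cases a <;> fin_cases b <;> fin_cases c <;> fin_cases d <;>
      simp [Wp, phiPT_apply, Matrix.one_apply]
  · simp [Wp, Matrix.trace, phiPT_apply, Fintype.sum_prod_type]
    ring
  · intro A B hA hB
    have key : (Wp p * (A ⊗ₖ B)).trace
        = ((p / 2 : ℝ) : ℂ) * (A * B).trace + (((1 - p) / 4 : ℝ) : ℂ) * (A.trace * B.trace) := by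
      simp [Wp, Matrix.trace, phiPT_apply, Fintype.sum_prod_type, Matrix.mul_apply,
        Matrix.one_apply, Matrix.add_apply]
      ring
    have h : 0 ≤ (Wp p * (A ⊗ₖ B)).trace := by
      rw [key]
      have h1 : (0 : ℂ) ≤ ((p / 2 : ℝ) : ℂ) := Complex.zero_le_real.mpr (by linarith)
      have h2 : (0 : ℂ) ≤ (((1 - p) / 4 : ℝ) : ℂ) := Complex.zero_le_real.mpr (by linarith)
      exact add_nonneg (mul_nonneg h1 (trace_mul_nonneg_aux A B hA hB))
        (mul_nonneg h2 (mul_nonneg hA.trace_nonneg hB.trace_nonneg))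
    rw [Complex.nonneg_iff] at h
    exact ⟨h.1, h.2.symm⟩
end

section
/- (Proposition 1.) Let W_p = p·Γ[|φ⁺⟩⟨φ⁺|] + (1−p)·I/4 on ℂ²⊗ℂ² with 0 ≤ p ≤ 5/12. Then the classical-input classical-output correlations of W_p admit a local hidden variable model for all POVMs: there exist a measurable space Λ, a probability measure ω on Λ, and, for every n ∈ ℕ and every n-outcome qubit POVM M = (M₁,…,M_n) (positive semidefinite 2×2 matrices summing to I), response functions p_A(·|M,·), p_B(·|M,·) : {1,…,n} × Λ → [0,1] satisfying Σᵢ p_A(i|M,λ) = 1 and Σᵢ p_B(i|M,λ) = 1 for all λ, such that for all qubit POVMs A = (A₁,…,A_m) and B = (B₁,…,B_n) and all outcomes i, j: Tr[W_p (Aᵢ ⊗ B_j)] = ∫_Λ p_A(i|A,λ) · p_B(j|B,λ) dω(λ). -/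
open Matrix Kronecker ComplexOrder

/-- An n-outcome POVM on ℂ^d: positive semidefinite matrices summing to the identity. -/
def IsPOVM {d n : ℕ} (M : Fin n → Matrix (Fin d) (Fin d) ℂ) : Prop :=
  (∀ i, (M i).PosSemidef) ∧ ∑ i, M i = 1

/-- A local hidden variable model, for all POVMs, of a bipartite qubit operator σ:
a probability space (Hidden, ω) together with, for every n-outcome qubit POVM on either side,
response functions valued in [0,1] and summing to 1 over outcomes, whose product
integrated against ω reproduces all joint Born probabilities Tr[σ(Aᵢ ⊗ B_j)]. -/
structure LHVModelPOVM (σ : Matrix (Fin 2 × Fin 2) (Fin 2 × Fin 2) ℂ) where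
  Hidden : Type
  [mHidden : MeasurableSpace Hidden]
  ω : MeasureTheory.Measure Hidden
  prob : MeasureTheory.IsProbabilityMeasure ω
  pA : (n : ℕ) → (Fin n → Matrix (Fin 2) (Fin 2) ℂ) → Fin n → Hidden → ℝ
  pB : (n : ℕ) → (Fin n → Matrix (Fin 2) (Fin 2) ℂ) → Fin n → Hidden → ℝ
  pA_mem : ∀ (n : ℕ) (M : Fin n → Matrix (Fin 2) (Fin 2) ℂ), IsPOVM M →
    ∀ i lam, 0 ≤ pA n M i lam ∧ pA n M i lam ≤ 1
  pB_mem : ∀ (n : ℕ) (M : Fin n → Matrix (Fin 2) (Fin 2) ℂ), IsPOVM M →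
    ∀ i lam, 0 ≤ pB n M i lam ∧ pB n M i lam ≤ 1
  pA_sum : ∀ (n : ℕ) (M : Fin n → Matrix (Fin 2) (Fin 2) ℂ), IsPOVM M →
    ∀ lam, ∑ i, pA n M i lam = 1
  pB_sum : ∀ (n : ℕ) (M : Fin n → Matrix (Fin 2) (Fin 2) ℂ), IsPOVM M →
    ∀ lam, ∑ i, pB n M i lam = 1
  born : ∀ (m n : ℕ) (A : Fin m → Matrix (Fin 2) (Fin 2) ℂ)
    (B : Fin n → Matrix (Fin 2) (Fin 2) ℂ), IsPOVM A → IsPOVM B →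
    ∀ (i : Fin m) (j : Fin n),
      (σ * (A i ⊗ₖ B j)).trace = ((∫ lam, pA m A i lam * pB n B j lam ∂ω : ℝ) : ℂ)

open MeasureTheory Real
abbrev E3 := EuclideanSpace ℝ (Fin 3)

lemma radial_int : ∫ x : E3, ‖x‖ * exp (-‖x‖^2) = 2 * π := by
  rw [integral_fun_norm_addHaar (volume : Measure E3) (fun r => r * exp (-r^2))]
  have h1 : ∫ y in Set.Ioi (0:ℝ), y ^ (Module.finrank ℝ E3 - 1) • (y * exp (-y^2)) = 1/2 := by
    have := integral_rpow_mul_exp_neg_rpow (p := 2) (q := 3) (by norm_num) (by norm_num)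
    rw [show (1/2:ℝ) = 1/2 * Gamma ((3+1)/2) by norm_num [Real.Gamma_two], ← this]
    refine setIntegral_congr_fun measurableSet_Ioi fun y hy => ?_
    simp only [finrank_euclideanSpace, Fintype.card_fin, smul_eq_mul]
    rw [show (3:ℝ) = ((3:ℕ):ℝ) by norm_num, rpow_natCast, rpow_two]
    ring
  rw [h1]
  have h2 : (0:ℝ) ≤ π * 4 / 3 := by positivity
  simp only [Measure.real, EuclideanSpace.volume_ball_fin_three, finrank_euclideanSpace, Fintype.card_fin,
    ENNReal.toReal_mul, ENNReal.toReal_ofReal h2, ENNReal.ofReal_one, one_pow, ENNReal.toReal_one, smul_eq_mul, nsmul_eq_mul]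
  push_cast
  ring

lemma coord_int : ∫ x : E3, |x 0| * exp (-‖x‖^2) = π := by
  have e := (PiLp.volume_preserving_toLp (Fin 3)).integral_comp
    (MeasurableEquiv.toLp 2 (Fin 3 → ℝ)).measurableEmbedding (fun x : E3 => |x 0| * exp (-‖x‖^2))
  rw [← e]
  have h := integral_fintype_prod_volume_eq_prod (𝕜 := ℝ) (ι := Fin 3)
    (E := fun _ => ℝ) (fun i t => if i = 0 then |t| * exp (-1 * t^2) else exp (-1 * t^2))
  simp only [Fin.prod_univ_three] at h
  have h0 : ∫ t : ℝ, |t| * exp (-1 * t^2) = 1 := by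
    have := integral_comp_abs (f := fun t => t * exp (-1 * t^2))
    simp only [sq_abs] at this
    rw [this]
    have := integral_rpow_mul_exp_neg_rpow (p := 2) (q := 1) (by norm_num) (by norm_num)
    have h3 : (1 / 2 : ℝ) * Gamma ((1+1)/2) = 1 / 2 := by norm_num
    rw [h3] at this
    rw [show ∫ x in Set.Ioi (0:ℝ), x * exp (-1 * x^2) = 1/2 from ?_]
    · norm_num
    rw [← this]
    refine setIntegral_congr_fun measurableSet_Ioi fun y hy => ?_
    simp [rpow_two]
  have h1 := integral_gaussian 1
  simp only [if_true, Fin.isValue, one_ne_zero, if_false, show (2 : Fin 3) ≠ 0 by decide] at h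
  rw [h0, h1] at h
  have h2 : π = 1 * √(π/1) * √(π/1) := by
    rw [div_one, one_mul, mul_self_sqrt pi_pos.le]
  rw [h2, ← h]
  congr 1
  ext x
  rw [EuclideanSpace.norm_sq_eq]
  simp only [Fin.sum_univ_three, norm_eq_abs, sq_abs]
  rw [mul_assoc, mul_assoc, ← exp_add, ← exp_add]
  congr 2
  ring

noncomputable def dens (x : E3) : ℝ := ‖x‖ * exp (-‖x‖^2) / (2 * π)

noncomputable def om : Measure E3 := volume.withDensity fun x => ENNReal.ofReal (dens x)

lemma dens_nonneg (x : E3) : 0 ≤ dens x := by unfold dens; positivity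
lemma dens_cont : Continuous dens := by unfold dens; fun_prop
lemma dens_int : ∫ x, dens x = 1 := by
  unfold dens
  rw [integral_div, radial_int, div_self (by positivity)]
lemma om_integral (f : E3 → ℝ) : ∫ x, f x ∂om = ∫ x, dens x * f x := by
  unfold om
  rw [integral_withDensity_eq_integral_toReal_smul]
  · simp [ENNReal.toReal_ofReal (dens_nonneg _)]
  · exact dens_cont.measurable.ennreal_ofReal
  · simp
instance om_prob : IsProbabilityMeasure om := by
  constructor
  unfold om
  rw [withDensity_apply _ MeasurableSet.univ, Measure.restrict_univ,
    ← ofReal_integral_eq_lintegral_ofReal, dens_int, ENNReal.ofReal_one]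
  · by_contra h
    have := integral_undef h
    rw [dens_int] at this
    norm_num at this
  · exact Filter.Eventually.of_forall dens_nonneg

lemma om_inv (L : E3 ≃ₗᵢ[ℝ] E3) (f : E3 → ℝ) : ∫ x, f (L x) ∂om = ∫ x, f x ∂om := by
  rw [om_integral, om_integral]
  rw [← (L.measurePreserving).integral_comp L.toMeasurableEquiv.measurableEmbedding (fun x => dens x * f x)]
  simp [dens]

/-- direction inner product -/
noncomputable def sd (v x : E3) : ℝ := inner ℝ v (‖x‖⁻¹ • x)

lemma sd_iso (L : E3 ≃ₗᵢ[ℝ] E3) (v x : E3) : sd (L v) (L x) = sd v x := by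
  unfold sd
  rw [L.norm_map, ← map_smul, L.inner_map_map]
lemma sd_abs (v x : E3) : |sd v x| ≤ ‖v‖ := by
  unfold sd
  refine (abs_real_inner_le_norm _ _).trans ?_
  rw [norm_smul, norm_inv, norm_norm]
  have : ‖x‖⁻¹ * ‖x‖ ≤ 1 := inv_mul_le_one
  nlinarith [norm_nonneg v]
lemma sd_meas (v : E3) : Measurable (sd v) := by unfold sd; fun_prop
lemma sd_add (v w x : E3) : sd (v + w) x = sd v x + sd w x := by simp [sd, inner_add_left]
lemma sd_smul (c : ℝ) (v x : E3) : sd (c • v) x = c * sd v x := by simp [sd, real_inner_smul_left]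
lemma sd_neg (v x : E3) : sd (-v) x = - sd v x := by simp [sd]

lemma om_odd (f : E3 → ℝ) (h : ∀ x, f (-x) = - f x) : ∫ x, f x ∂om = 0 := by
  have := om_inv (LinearIsometryEquiv.neg ℝ) f
  simp only [LinearIsometryEquiv.coe_neg, h, integral_neg] at this
  linarith

lemma int_bdd {f : E3 → ℝ} (hf : Measurable f) (C : ℝ) (h : ∀ x, |f x| ≤ C) : Integrable f om :=
  Integrable.of_bound hf.aestronglyMeasurable C (Filter.Eventually.of_forall h)

lemma om_orth (ψ : ℝ → ℝ) (v w : E3) (h : inner ℝ v w = 0) :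
    ∫ x, ψ (sd v x) * sd w x ∂om = 0 := by
  let L := (ℝ ∙ v).reflection
  have hv : L v = v := Submodule.reflection_mem_subspace_eq_self (Submodule.mem_span_singleton_self v)
  have hw : L w = -w := Submodule.reflection_mem_subspace_orthogonalComplement_eq_neg
    (Submodule.mem_orthogonal_singleton_iff_inner_right.2 h)
  have := om_inv L (fun x => ψ (sd v x) * sd w x)
  have e : ∀ x, ψ (sd v (L x)) * sd w (L x) = - (ψ (sd v x) * sd w x) := by
    intro x
    have h1 := sd_iso L v x
    have h2 := sd_iso L w x
    rw [hv] at h1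
    rw [hw, sd_neg] at h2
    rw [h1, ← h2]; ring
  simp only [e, integral_neg] at this
  linarith

lemma om_rot (ψ : ℝ → ℝ) (v w : E3) (h : ‖v‖ = ‖w‖) :
    ∫ x, ψ (sd v x) ∂om = ∫ x, ψ (sd w x) ∂om := by
  rw [← Submodule.reflection_sub h]
  rw [← om_inv (Submodule.reflection (ℝ ∙ (v - w))ᗮ) fun x => ψ (sd (Submodule.reflection (ℝ ∙ (v - w))ᗮ v) x)]
  simp only [sd_iso]

lemma sd_single (i : Fin 3) (x : E3) : sd (EuclideanSpace.single i 1) x = ‖x‖⁻¹ * x i := by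
  simp [sd, EuclideanSpace.inner_single_left]

lemma om_abs (v : E3) : ∫ x, |sd v x| ∂om = ‖v‖ / 2 := by
  rw [om_rot (fun t => |t|) v (‖v‖ • EuclideanSpace.single 0 1) (by simp [norm_smul])]
  simp only [sd_smul, abs_mul, abs_norm, integral_const_mul, sd_single]
  rw [om_integral]
  have : ∀ x : E3, dens x * (|‖x‖⁻¹| * |x 0|) = (|x 0| * exp (-‖x‖^2)) / (2 * π) := by
    intro x
    unfold dens
    by_cases hx : x = 0
    · simp [hx]
    · have : ‖x‖ ≠ 0 := norm_ne_zero_iff.2 hx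
      rw [abs_inv, abs_norm]
      field_simp
  simp only [this]
  rw [integral_div, coord_int]
  have := pi_ne_zero
  field_simp

lemma om_sq (v : E3) : ∫ x, sd v x ^ 2 ∂om = ‖v‖^2 / 3 := by
  rw [om_rot (fun t => t^2) v (‖v‖ • EuclideanSpace.single 0 1) (by simp [norm_smul])]
  simp only [sd_smul, mul_pow, integral_const_mul]
  have hi : ∀ i : Fin 3, ∫ x, sd (EuclideanSpace.single i 1) x ^ 2 ∂om = ∫ x, sd (EuclideanSpace.single 0 1) x ^ 2 ∂om :=
    fun i => om_rot (fun t => t^2) _ _ (by simp)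
  have hint : ∀ i : Fin 3, Integrable (fun x => sd (EuclideanSpace.single i 1) x ^ 2) om := by
    intro i
    refine int_bdd ((sd_meas _).pow_const 2) 1 fun x => ?_
    have := sd_abs (EuclideanSpace.single i 1) x
    rw [abs_pow]
    refine pow_le_one₀ (abs_nonneg _) (this.trans (by simp))
  have hs : ∫ x, ∑ i : Fin 3, sd (EuclideanSpace.single i 1) x ^ 2 ∂om = 1 := by
    have : ∫ x : E3, (1:ℝ) ∂om = 1 := by simp
    refine Eq.trans ?_ this
    rw [om_integral, om_integral]
    congr 1
    ext x
    by_cases hx : x = 0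
    · simp [hx, dens]
    · have h0 : ‖x‖ ≠ 0 := norm_ne_zero_iff.2 hx
      congr 1
      simp only [sd_single, mul_pow]
      rw [← Finset.mul_sum, ← EuclideanSpace.real_norm_sq_eq]
      field_simp
  rw [integral_finsetSum _ fun i _ => hint i] at hs
  simp only [hi, Finset.sum_const, Finset.card_univ, Fintype.card_fin] at hs
  rw [nsmul_eq_mul] at hs
  push_cast at hs
  linear_combination ‖v‖^2 / 3 * hs

lemma om_lin (ψ : ℝ → ℝ) (hψ : Measurable ψ) (v w : E3) (C : ℝ) (hC : ∀ x, |ψ (sd v x)| ≤ C) :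
    ‖v‖^2 * ∫ x, ψ (sd v x) * sd w x ∂om = inner ℝ v w * ∫ x, ψ (sd v x) * sd v x ∂om := by
  have hint : ∀ u : E3, Integrable (fun x => ψ (sd v x) * sd u x) om := by
    intro u
    refine int_bdd ((hψ.comp (sd_meas v)).mul (sd_meas u)) (C * ‖u‖) fun x => ?_
    rw [abs_mul]
    exact mul_le_mul (hC x) (sd_abs u x) (abs_nonneg _) ((abs_nonneg _).trans (hC x))
  have h := om_orth ψ v (‖v‖^2 • w + (-(inner ℝ v w)) • v) (by
    rw [inner_add_right, real_inner_smul_right, real_inner_smul_right, real_inner_self_eq_norm_sq]; ring)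
  have e : ∀ x, ψ (sd v x) * sd (‖v‖^2 • w + (-(inner ℝ v w)) • v) x
      = ‖v‖^2 * (ψ (sd v x) * sd w x) + (-(inner ℝ v w)) * (ψ (sd v x) * sd v x) := by
    intro x; rw [sd_add, sd_smul, sd_smul]; ring
  simp only [e] at h
  rw [integral_add ((hint w).const_mul _) ((hint v).const_mul _), integral_const_mul, integral_const_mul] at h
  linarith

noncomputable def sg (t : ℝ) : ℝ := if 0 < t then 1 else if t < 0 then -1 else 0
lemma sg_meas : Measurable sg :=
  Measurable.ite measurableSet_Ioi measurable_const (Measurable.ite measurableSet_Iio measurable_const measurable_const)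
lemma sg_abs (t : ℝ) : |sg t| ≤ 1 := by unfold sg; split_ifs <;> simp
lemma sg_mul (t : ℝ) : sg t * t = |t| := by
  unfold sg; split_ifs with h1 h2
  · rw [abs_of_pos h1, one_mul]
  · rw [abs_of_neg h2]; ring
  · rw [show t = 0 by linarith]; simp
lemma sg_neg (t : ℝ) : sg (-t) = - sg t := by
  unfold sg; split_ifs <;> linarith

noncomputable def KK (v x : E3) : ℝ := (‖v‖ + sd v x + ‖v‖ * sg (sd v x) + |sd v x|) / 4

lemma sd_negx (v x : E3) : sd v (-x) = - sd v x := by simp [sd]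
lemma sd_int (v : E3) : Integrable (sd v) om := int_bdd (sd_meas v) _ (sd_abs v)
lemma sd_zero_int (v : E3) : ∫ x, sd v x ∂om = 0 := om_odd _ (sd_negx v)
lemma KK_nonneg (v x : E3) : 0 ≤ KK v x := by
  have h := sd_abs v x
  have h1 := (abs_le.1 (sg_abs (sd v x))).1
  have := norm_nonneg v
  unfold KK
  rcases abs_cases (sd v x) with ⟨h2, h3⟩ | ⟨h2, h3⟩ <;> nlinarith
lemma KK_le (v x : E3) : KK v x ≤ (‖v‖ + sd v x) / 2 := by
  have h := abs_le.1 (sd_abs v x)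
  have h1 := (abs_le.1 (sg_abs (sd v x)))
  have h4 := sg_mul (sd v x)
  unfold KK
  rw [← h4]
  nlinarith
lemma KK_meas (v : E3) : Measurable (KK v) := by
  have h1 := sd_meas v
  have h2 := sg_meas.comp h1
  unfold KK
  exact (((h1.const_add _).add (h2.const_mul _)).add (by simpa using h1.norm)).div_const _
lemma KK_intble (v : E3) : Integrable (KK v) om := by
  refine int_bdd (KK_meas v) ‖v‖ fun x => ?_
  rw [abs_of_nonneg (KK_nonneg v x)]
  have := KK_le v x
  have := abs_le.1 (sd_abs v x)
  linarith
lemma mul_sd_int {f : E3 → ℝ} (hf : Integrable f om) (w : E3) : Integrable (fun x => f x * sd w x) om :=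
  hf.mul_bdd (c := ‖w‖) (sd_meas w).aestronglyMeasurable (Filter.Eventually.of_forall (sd_abs w))
lemma sg_intble (v : E3) : Integrable (fun x => sg (sd v x)) om :=
  int_bdd (sg_meas.comp (sd_meas v)) 1 fun x => sg_abs _

lemma lin4 {f1 f2 f3 f4 : E3 → ℝ} (h1 : Integrable f1 om) (h2 : Integrable f2 om)
    (h3 : Integrable f3 om) (h4 : Integrable f4 om) (a b c d : ℝ) :
    ∫ x, (a * f1 x + b * f2 x + (c * f3 x + d * f4 x)) ∂om =
      a * (∫ x, f1 x ∂om) + b * (∫ x, f2 x ∂om) + (c * (∫ x, f3 x ∂om) + d * (∫ x, f4 x ∂om)) := by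
  have h12 : Integrable (fun x => a * f1 x + b * f2 x) om := (h1.const_mul a).add (h2.const_mul b)
  have h34 : Integrable (fun x => c * f3 x + d * f4 x) om := (h3.const_mul c).add (h4.const_mul d)
  rw [integral_add h12 h34, integral_add (h1.const_mul a) (h2.const_mul b),
    integral_add (h3.const_mul c) (h4.const_mul d)]
  simp only [integral_const_mul]

lemma KK_int (v : E3) : ∫ x, KK v x ∂om = 3 / 8 * ‖v‖ := by
  have i1 := sd_int v
  have i2 := sg_intble v
  have z : ∫ x, sg (sd v x) ∂om = 0 := om_odd _ fun x => by rw [sd_negx, sg_neg]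
  have e : ∀ x, KK v x = ‖v‖ / 4 * 1 + 1/4 * sd v x + (‖v‖ / 4 * sg (sd v x) + 1/4 * |sd v x|) := by
    intro x; unfold KK; ring
  simp only [e]
  rw [lin4 (integrable_const 1) i1 i2 i1.abs, z, sd_zero_int, om_abs]
  simp
  ring

lemma KK_sd_int (v w : E3) : ∫ x, KK v x * sd w x ∂om = 5 / 24 * inner ℝ v w := by
  by_cases hv : v = 0
  · subst hv; simp [KK, sd]
  have hn : ‖v‖ ≠ 0 := norm_ne_zero_iff.2 hv
  have i1 := mul_sd_int (sd_int v) w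
  have i2 := mul_sd_int (sg_intble v) w
  have i3 := mul_sd_int (sd_int v).abs w
  have i0 := sd_int w
  have e1 := om_lin id measurable_id v w ‖v‖ (sd_abs v)
  have e2 := om_lin sg sg_meas v w 1 (fun x => sg_abs _)
  simp only [id, ← pow_two, om_sq] at e1
  simp only [sg_mul, om_abs] at e2
  have e3 : ∫ x, |sd v x| * sd w x ∂om = 0 := om_odd _ fun x => by simp [sd_negx]
  have e : ∀ x, KK v x * sd w x = (‖v‖ / 4 * sd w x + 1/4 * (sd v x * sd w x)) +
      (‖v‖ / 4 * (sg (sd v x) * sd w x) + 1/4 * (|sd v x| * sd w x)) := by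
    intro x; unfold KK; ring
  simp only [e]
  rw [lin4 i0 i1 i2 i3, sd_zero_int, e3]
  have e1' : ∫ x, sd v x * sd w x ∂om = inner ℝ v w / 3 := by
    apply mul_left_cancel₀ (pow_ne_zero 2 hn); linarith
  have e2' : ‖v‖ * ∫ x, sg (sd v x) * sd w x ∂om = inner ℝ v w / 2 := by
    apply mul_left_cancel₀ hn; linarith
  rw [e1']
  linear_combination e2' / 4

noncomputable def al (M : Matrix (Fin 2) (Fin 2) ℂ) : ℝ := (M 0 0 + M 1 1).re
noncomputable def bv (M : Matrix (Fin 2) (Fin 2) ℂ) : E3 :=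
  !₂[2 * (M 0 1).re, 2 * (M 0 1).im, (M 0 0 - M 1 1).re]

lemma psd_facts {M : Matrix (Fin 2) (Fin 2) ℂ} (h : M.PosSemidef) :
    (M 0 0).im = 0 ∧ (M 1 1).im = 0 ∧ (M 1 0).re = (M 0 1).re ∧ (M 1 0).im = -(M 0 1).im ∧
    0 ≤ (M 0 0).re ∧ 0 ≤ (M 1 1).re := by
  have h0 := h.diag_nonneg (i := 0)
  have h1 := h.diag_nonneg (i := 1)
  have h2 := h.isHermitian.apply 1 0
  rw [Complex.le_def] at h0 h1
  rw [← h2]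
  simp at h0 h1 ⊢
  exact ⟨h0.2.symm, h1.2.symm, h0.1, h1.1⟩

lemma bv_norm {M : Matrix (Fin 2) (Fin 2) ℂ} (h : M.PosSemidef) : ‖bv M‖ ≤ al M := by
  obtain ⟨h1, h2, h3, h4, h5, h6⟩ := psd_facts h
  have hd := h.det_nonneg
  rw [Matrix.det_fin_two, Complex.le_def] at hd
  have hd := hd.1
  simp only [Complex.zero_re, Complex.sub_re, Complex.mul_re, h1, h2, h3, h4] at hd
  apply abs_le_of_sq_le_sq' _ _ |>.2
  · rw [EuclideanSpace.norm_sq_eq]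
    simp [Fin.sum_univ_three, bv, al]
    nlinarith
  · simp [al]; linarith

lemma bv_inner (M N : Matrix (Fin 2) (Fin 2) ℂ) : inner ℝ (bv M) (bv N) =
    4 * (M 0 1).re * (N 0 1).re + 4 * (M 0 1).im * (N 0 1).im
      + ((M 0 0).re - (M 1 1).re) * ((N 0 0).re - (N 1 1).re) := by
  simp [bv, PiLp.inner_apply, Fin.sum_univ_three]
  ring

lemma al_sum {n : ℕ} {M : Fin n → Matrix (Fin 2) (Fin 2) ℂ} (h : IsPOVM M) : ∑ i, al (M i) = 2 := by
  have h0 := congrArg Complex.re (congrFun (congrFun h.2 0) 0)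
  have h1 := congrArg Complex.re (congrFun (congrFun h.2 1) 1)
  simp [Matrix.sum_apply] at h0 h1
  simp [al, Finset.sum_add_distrib, h0, h1]
  norm_num

lemma bv_sum {n : ℕ} {M : Fin n → Matrix (Fin 2) (Fin 2) ℂ} (h : IsPOVM M) : ∑ i, bv (M i) = 0 := by
  have h0 := congrArg Complex.re (congrFun (congrFun h.2 0) 0)
  have h1 := congrArg Complex.re (congrFun (congrFun h.2 1) 1)
  have h2 := congrArg Complex.re (congrFun (congrFun h.2 0) 1)
  have h3 := congrArg Complex.im (congrFun (congrFun h.2 0) 1)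
  simp [Matrix.sum_apply] at h0 h1 h2 h3
  ext i
  fin_cases i <;> simp [bv, ← Finset.mul_sum, Finset.sum_sub_distrib, h0, h1, h2, h3]

lemma sd_sum {n : ℕ} {M : Fin n → Matrix (Fin 2) (Fin 2) ℂ} (h : IsPOVM M) (x : E3) :
    ∑ i, sd (bv (M i)) x = 0 := by
  unfold sd
  rw [← sum_inner, bv_sum h, inner_zero_left]

noncomputable def gg (M : Matrix (Fin 2) (Fin 2) ℂ) (x : E3) : ℝ :=
  KK (bv M) x + (al M - ‖bv M‖) * (3 / 8)

lemma gg_nonneg {M : Matrix (Fin 2) (Fin 2) ℂ} (h : M.PosSemidef) (x : E3) : 0 ≤ gg M x := by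
  have := bv_norm h
  have := KK_nonneg (bv M) x
  unfold gg; linarith
lemma gg_le {M : Matrix (Fin 2) (Fin 2) ℂ} (h : M.PosSemidef) (x : E3) :
    gg M x ≤ (al M + sd (bv M) x) / 2 := by
  have := bv_norm h
  have := KK_le (bv M) x
  unfold gg; linarith

noncomputable def resB (n : ℕ) (M : Fin n → Matrix (Fin 2) (Fin 2) ℂ) (i : Fin n) (x : E3) : ℝ :=
  (al (M i) + sd (bv (M i)) x) / 2
noncomputable def resA (q : ℝ) (n : ℕ) (M : Fin n → Matrix (Fin 2) (Fin 2) ℂ) (i : Fin n) (x : E3) : ℝ :=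
  q * (gg (M i) x + al (M i) / 2 * (1 - ∑ k, gg (M k) x)) + (1 - q) * (al (M i) / 2)

lemma resB_sum {n : ℕ} {M : Fin n → Matrix (Fin 2) (Fin 2) ℂ} (h : IsPOVM M) (x : E3) :
    ∑ i, resB n M i x = 1 := by
  unfold resB
  rw [← Finset.sum_div, Finset.sum_add_distrib, al_sum h, sd_sum h]; norm_num
lemma resB_nonneg {n : ℕ} {M : Fin n → Matrix (Fin 2) (Fin 2) ℂ} (h : IsPOVM M) (i : Fin n) (x : E3) :
    0 ≤ resB n M i x := (gg_nonneg (h.1 i) x).trans (gg_le (h.1 i) x)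
lemma gsum_le {n : ℕ} {M : Fin n → Matrix (Fin 2) (Fin 2) ℂ} (h : IsPOVM M) (x : E3) :
    ∑ k, gg (M k) x ≤ 1 := by
  rw [← resB_sum h x]
  exact Finset.sum_le_sum fun k _ => gg_le (h.1 k) x
lemma resA_sum (q : ℝ) {n : ℕ} {M : Fin n → Matrix (Fin 2) (Fin 2) ℂ} (h : IsPOVM M) (x : E3) :
    ∑ i, resA q n M i x = 1 := by
  unfold resA
  rw [Finset.sum_add_distrib, ← Finset.mul_sum, ← Finset.mul_sum, Finset.sum_add_distrib,
    ← Finset.sum_mul, ← Finset.sum_div, al_sum h]; ring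
lemma resA_nonneg {q : ℝ} (h0 : 0 ≤ q) (h1 : q ≤ 1) {n : ℕ} {M : Fin n → Matrix (Fin 2) (Fin 2) ℂ}
    (h : IsPOVM M) (i : Fin n) (x : E3) : 0 ≤ resA q n M i x := by
  have a := gg_nonneg (h.1 i) x
  have b : 0 ≤ 1 - ∑ k, gg (M k) x := sub_nonneg.2 (gsum_le h x)
  have c : 0 ≤ al (M i) := (norm_nonneg _).trans (bv_norm (h.1 i))
  have d : 0 ≤ 1 - q := sub_nonneg.2 h1
  unfold resA
  positivity
lemma le_one_of_sum {n : ℕ} {f : Fin n → ℝ} (h0 : ∀ i, 0 ≤ f i) (h1 : ∑ i, f i = 1) (i : Fin n) : f i ≤ 1 := by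
  rw [← h1]
  exact Finset.single_le_sum (fun j _ => h0 j) (Finset.mem_univ i)

lemma gg_intble (M : Matrix (Fin 2) (Fin 2) ℂ) : Integrable (gg M) om :=
  (KK_intble _).add (integrable_const _)

lemma gg_int (M : Matrix (Fin 2) (Fin 2) ℂ) (β : ℝ) (w : E3) :
    ∫ x, gg M x * ((β + sd w x) / 2) ∂om = 3 / 16 * al M * β + 5 / 48 * inner ℝ (bv M) w := by
  have e : ∀ x, gg M x * ((β + sd w x) / 2) = β / 2 * KK (bv M) x + 1 / 2 * (KK (bv M) x * sd w x)
      + (((al M - ‖bv M‖) * (3 / 8) / 2) * sd w x + ((al M - ‖bv M‖) * (3 / 8) * β / 2) * 1) := by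
    intro x; unfold gg; ring
  simp only [e]
  rw [lin4 (KK_intble _) (mul_sd_int (KK_intble _) w) (sd_int w) (integrable_const 1),
    KK_int, KK_sd_int, sd_zero_int]
  simp
  ring

lemma gsum_int {n : ℕ} {M : Fin n → Matrix (Fin 2) (Fin 2) ℂ} (h : IsPOVM M) (β : ℝ) (w : E3) :
    ∫ x, (∑ k, gg (M k) x) * ((β + sd w x) / 2) ∂om = 3 / 8 * β := by
  simp only [Finset.sum_mul]
  rw [integral_finsetSum]
  · simp only [gg_int]
    rw [Finset.sum_add_distrib, ← Finset.sum_mul, ← Finset.mul_sum, ← Finset.mul_sum, ← sum_inner,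
      al_sum h, bv_sum h, inner_zero_left]
    ring
  · intro i _
    have := (((gg_intble (M i)).const_mul (β / 2)).add ((mul_sd_int (gg_intble (M i)) w).const_mul (1/2)))
    refine this.congr (Filter.Eventually.of_forall fun x => ?_)
    simp only [Pi.add_apply]; ring

lemma gmul_intble {f : E3 → ℝ} (hf : Integrable f om) (β : ℝ) (w : E3) :
    Integrable (fun x => f x * ((β + sd w x) / 2)) om := by
  have := ((hf.const_mul (β / 2)).add ((mul_sd_int hf w).const_mul (1/2)))
  refine this.congr (Filter.Eventually.of_forall fun x => ?_)
  simp only [Pi.add_apply]; ring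

lemma res_int (q : ℝ) {m n : ℕ} {A : Fin m → Matrix (Fin 2) (Fin 2) ℂ} (hA : IsPOVM A)
    (B : Fin n → Matrix (Fin 2) (Fin 2) ℂ) (i : Fin m) (j : Fin n) :
    ∫ x, resA q m A i x * resB n B j x ∂om =
      al (A i) * al (B j) / 4 + q * (5 / 48) * inner ℝ (bv (A i)) (bv (B j)) := by
  have e : ∀ x, resA q m A i x * resB n B j x =
      q * (gg (A i) x * ((al (B j) + sd (bv (B j)) x) / 2))
      + (- (q * (al (A i) / 2))) * ((∑ k, gg (A k) x) * ((al (B j) + sd (bv (B j)) x) / 2))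
      + ((al (A i) / 4) * sd (bv (B j)) x + (al (A i) * al (B j) / 4) * 1) := by
    intro x; unfold resA resB; ring
  simp only [e]
  rw [lin4 (gmul_intble (gg_intble _) _ _)
    (gmul_intble (integrable_finsetSum _ fun k _ => gg_intble (A k)) _ _) (sd_int _) (integrable_const 1),
    gg_int, gsum_int hA, sd_zero_int]
  simp
  ring

lemma born_tr (p : ℝ) {A B : Matrix (Fin 2) (Fin 2) ℂ} (hA : A.PosSemidef) (hB : B.PosSemidef) :
    (Wp p * (A ⊗ₖ B)).trace = ((al A * al B / 4 + p / 4 * inner ℝ (bv A) (bv B) : ℝ) : ℂ) := by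
  obtain ⟨a1, a2, a3, a4, -, -⟩ := psd_facts hA
  obtain ⟨b1, b2, b3, b4, -, -⟩ := psd_facts hB
  have hs : ((Real.sqrt 2 : ℂ))⁻¹ * ((Real.sqrt 2 : ℂ))⁻¹ = 1 / 2 := by
    rw [← mul_inv, ← Complex.ofReal_mul, Real.mul_self_sqrt (by norm_num)]; norm_num
  have h : (Wp p * (A ⊗ₖ B)).trace = p / 2 * (A 0 0 * B 0 0 + A 0 1 * B 1 0 + A 1 0 * B 0 1 + A 1 1 * B 1 1)
      + (1 - p) / 4 * ((A 0 0 + A 1 1) * (B 0 0 + B 1 1)) := by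
    simp [Wp, Matrix.trace, Matrix.mul_apply, Fintype.sum_prod_type, phiPlusPT, phiPlusProj, phiPlus,
      Matrix.one_apply, Matrix.kroneckerMap_apply, Matrix.add_apply, Matrix.smul_apply, hs]
    ring
  rw [h, bv_inner]
  unfold al
  apply Complex.ext
  · simp [a1, a2, a3, a4, b1, b2, b3, b4, Complex.div_re, Complex.div_im, Complex.normSq]
    ring
  · simp [a1, a2, a3, a4, b1, b2, b3, b4, Complex.div_re, Complex.div_im, Complex.normSq]
    right; ring

/-- Proposition 1: for 0 ≤ p ≤ 5/12, the classical-input classical-output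
correlations of W_p admit a local hidden variable model for all POVMs. -/
theorem stmt3 (p : ℝ) (hp0 : 0 ≤ p) (hp1 : p ≤ 5 / 12) :
    Nonempty (LHVModelPOVM (Wp p)) := by
  have q0 : 0 ≤ 12 / 5 * p := by positivity
  have q1 : 12 / 5 * p ≤ 1 := by linarith
  exact ⟨{
    Hidden := E3
    ω := om
    prob := om_prob
    pA := resA (12 / 5 * p)
    pB := resB
    pA_mem := fun n M h i x => ⟨resA_nonneg q0 q1 h i x,
      le_one_of_sum (fun k => resA_nonneg q0 q1 h k x) (resA_sum _ h x) i⟩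
    pB_mem := fun n M h i x => ⟨resB_nonneg h i x,
      le_one_of_sum (fun k => resB_nonneg h k x) (resB_sum h x) i⟩
    pA_sum := fun n M h x => resA_sum _ h x
    pB_sum := fun n M h x => resB_sum h x
    born := fun m n A B hA hB i j => by
      rw [res_int _ hA, born_tr p (hA.1 i) (hB.1 j)]
      congr 1
      ring }⟩
end

section
/- For every x ∈ ℝ, the double integral ∫_{θ=π/2}^{π} ∫_{φ=0}^{2π} (1/(4π)) · sin θ · (1/2) · (1 − sin x · sin θ · cos φ − cos x · cos θ) dφ dθ equals 1/4 + (cos x)/8. -/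
open Real

/-- the hidden-variable integral for the projective LHV model of W_{1/2}:
∫_{θ=π/2}^{π} ∫_{φ=0}^{2π} (1/(4π))·sin θ·(1/2)·(1 − sin x sin θ cos φ − cos x cos θ) dφ dθ
  = 1/4 + (cos x)/8. -/
theorem stmt5 (x : ℝ) :
    (∫ θ in (π / 2)..π, ∫ φ in (0 : ℝ)..(2 * π),
        (1 / (4 * π)) * Real.sin θ * (1 / 2) *
          (1 - Real.sin x * Real.sin θ * Real.cos φ - Real.cos x * Real.cos θ))
      = 1 / 4 + Real.cos x / 8 := by
  have inner : ∀ θ : ℝ, (∫ φ in (0 : ℝ)..(2 * π),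
        (1 / (4 * π)) * Real.sin θ * (1 / 2) *
          (1 - Real.sin x * Real.sin θ * Real.cos φ - Real.cos x * Real.cos θ))
      = (1 / 4) * (Real.sin θ * (1 - Real.cos x * Real.cos θ)) := by
    intro θ
    rw [intervalIntegral.integral_eq_sub_of_hasDerivAt
      (f := fun φ => (1 / (4 * π)) * Real.sin θ * (1 / 2) *
          (φ - Real.sin x * Real.sin θ * Real.sin φ - Real.cos x * Real.cos θ * φ))]
    · simp only [Real.sin_two_pi, Real.sin_zero]
      have := Real.pi_ne_zero
      field_simp
      ring
    · intro φ _
      have h := (((hasDerivAt_id φ).sub ((Real.hasDerivAt_sin φ).const_mul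
        (Real.sin x * Real.sin θ))).sub ((hasDerivAt_id φ).const_mul
        (Real.cos x * Real.cos θ))).const_mul ((1 / (4 * π)) * Real.sin θ * (1 / 2))
      refine HasDerivAt.congr_deriv h ?_
      ring
    · apply Continuous.intervalIntegrable
      fun_prop
  simp only [inner]
  rw [intervalIntegral.integral_eq_sub_of_hasDerivAt
      (f := fun θ => (1 / 4) * (Real.cos x / 2 * Real.cos θ ^ 2 - Real.cos θ))]
  · simp only [Real.cos_pi, Real.cos_pi_div_two]
    ring
  · intro θ _
    have h := ((((Real.hasDerivAt_cos θ).pow 2).const_mul (Real.cos x / 2)).sub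
      (Real.hasDerivAt_cos θ)).const_mul (1 / 4)
    refine HasDerivAt.congr_deriv h ?_
    push_cast
    ring
  · apply Continuous.intervalIntegrable
    fun_prop
end

section
/- (Theorem 1, bipartite.) Let W be a Hermitian unit-trace matrix on ℂ^{d_A}⊗ℂ^{d_B} that is POPT but not positive semidefinite. Then there exist finite index sets S, T, rank-one projections ψ_s on ℂ^{d_A} (s ∈ S) and φ_t on ℂ^{d_B} (t ∈ T), real coefficients β_{s,t}, and matrices π_A on ℂ^{d_A}⊗ℂ^{d_A} and π_B on ℂ^{d_B}⊗ℂ^{d_B} with 0 ≤ π_A ≤ I and 0 ≤ π_B ≤ I, such that: (i) Σ_{s,t} β_{s,t} · Tr[(π_A ⊗ π_B) · Z(ψ_s, W, φ_t)] < 0; and (ii) for every positive semidefinite unit-trace ρ on ℂ^{d_A}⊗ℂ^{d_B} and all matrices π'_A, π'_B with 0 ≤ π'_A ≤ I, 0 ≤ π'_B ≤ I: Σ_{s,t} β_{s,t} · Tr[(π'_A ⊗ π'_B) · Z(ψ_s, ρ, φ_t)] ≥ 0. -/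
open Matrix Kronecker ComplexOrder

/-- A rank-one projection on ℂ^d: Hermitian, idempotent, trace 1. -/
def RankOneProj {d : ℕ} (P : Matrix (Fin d) (Fin d) ℂ) : Prop :=
  P.IsHermitian ∧ P * P = P ∧ P.trace = 1

/-- A measurement effect: 0 ≤ π ≤ I. -/
def IsEffect {α : Type} [Fintype α] [DecidableEq α] (π : Matrix α α ℂ) : Prop :=
  π.PosSemidef ∧ (1 - π).PosSemidef

/-- The semiquantum arrangement Z(ψ, X, φ): the composite state in which Alice holds the
pair (A, A°) with quantum input ψ on A° and Bob holds (B, B°) with quantum input φ on B°;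
Z ((a,a°),(b,b°)) ((a',a°'),(b,b°')) = X (a,b) (a',b') · ψ a° a°' · φ b° b°'. -/
def Zar {dA dB : ℕ} (ψ : Matrix (Fin dA) (Fin dA) ℂ)
    (X : Matrix (Fin dA × Fin dB) (Fin dA × Fin dB) ℂ)
    (φ : Matrix (Fin dB) (Fin dB) ℂ) :
    Matrix ((Fin dA × Fin dA) × (Fin dB × Fin dB)) ((Fin dA × Fin dA) × (Fin dB × Fin dB)) ℂ :=
  Matrix.of fun x y =>
    X (x.1.1, x.2.1) (y.1.1, y.2.1) * ψ x.1.2 y.1.2 * φ x.2.2 y.2.2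

lemma aux_proj {ι : Type} [Fintype ι] [DecidableEq ι] (w : ι → ℂ) (n : ℝ) (hn : n ≠ 0)
    (hw : star w ⬝ᵥ w = (n : ℂ)) :
    (((n : ℂ)⁻¹ • vecMulVec w (star w)).IsHermitian) ∧
    ((n : ℂ)⁻¹ • vecMulVec w (star w)) * ((n : ℂ)⁻¹ • vecMulVec w (star w))
      = (n : ℂ)⁻¹ • vecMulVec w (star w) ∧
    ((n : ℂ)⁻¹ • vecMulVec w (star w)).trace = 1 := by
  have hn' : (n : ℂ) ≠ 0 := by exact_mod_cast hn
  refine ⟨?_, ?_, ?_⟩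
  · ext i j
    simp [vecMulVec_apply, mul_comm]
  · rw [smul_mul_smul_comm, vecMulVec_mul_vecMulVec, hw]
    ext i j
    simp [vecMulVec_apply]
    field_simp
  · rw [trace_smul, trace_vecMulVec, dotProduct_comm, hw, smul_eq_mul, inv_mul_cancel₀ hn']

lemma aux_effect {ι : Type} [Fintype ι] [DecidableEq ι] (P : Matrix ι ι ℂ)
    (h1 : P.IsHermitian) (h2 : P * P = P) : IsEffect P := by
  constructor
  · have := posSemidef_conjTranspose_mul_self P
    rwa [h1.eq, h2] at this
  · have := posSemidef_conjTranspose_mul_self (1 - P)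
    have h3 : (1 - P)ᴴ * (1 - P) = 1 - P := by
      rw [conjTranspose_sub, conjTranspose_one, h1.eq, mul_sub, sub_mul, sub_mul, h2]
      simp
    rwa [h3] at this

lemma aux_trace {ι : Type} [Fintype ι] [DecidableEq ι] {P Q : Matrix ι ι ℂ}
    (hP : P.PosSemidef) (hQ : Q.PosSemidef) : 0 ≤ (P * Q).trace := by
  obtain ⟨m, v, rfl⟩ := Matrix.posSemidef_iff_eq_sum_vecMulVec.1 hQ
  rw [Matrix.mul_sum, trace_sum]
  refine Finset.sum_nonneg fun i _ => ?_
  rw [mul_vecMulVec, trace_vecMulVec, dotProduct_comm]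
  exact hP.dotProduct_mulVec_nonneg _

lemma aux_span (d : ℕ) : ∃ (S : ℕ) (ψ : Fin S → Matrix (Fin d) (Fin d) ℂ)
    (c : Fin d → Fin d → Fin S → ℂ), (∀ s, RankOneProj (ψ s)) ∧
    ∀ i j, ∑ s, c i j s • ψ s = Matrix.single i j 1 := by
  let w : Fin d × Fin d × Fin 4 → Fin d → ℂ := fun x =>
    if x.1 = x.2.1 then Pi.single x.1 1 else Pi.single x.1 1 + Complex.I ^ (x.2.2 : ℕ) • Pi.single x.2.1 1
  let n : Fin d × Fin d × Fin 4 → ℝ := fun x => if x.1 = x.2.1 then 1 else 2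
  let ψ : Fin d × Fin d × Fin 4 → Matrix (Fin d) (Fin d) ℂ := fun x =>
    (n x : ℂ)⁻¹ • vecMulVec (w x) (star (w x))
  let c : Fin d → Fin d → Fin d × Fin d × Fin 4 → ℂ := fun i j x =>
    if i = x.1 then if j = x.2.1 then (if i = j then 1 / 4 else Complex.I ^ (x.2.2 : ℕ) / 2) else 0 else 0
  have hψ : ∀ x, RankOneProj (ψ x) := by
    rintro ⟨i, j, k⟩
    apply aux_proj
    · dsimp only [n]; split_ifs <;> norm_num
    · dsimp only [n, w]
      split_ifs with h
      · simp
      · have h' : j ≠ i := fun e => h e.symm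
        have hk : (starRingEnd ℂ) Complex.I ^ (k : ℕ) * Complex.I ^ (k : ℕ) = 1 := by
          rw [← mul_pow]; simp
        simp [h, h', add_dotProduct, dotProduct_add]
        simp at hk
        rw [mul_comm, hk]; norm_num
  have hc : ∀ i j, ∑ x, c i j x • ψ x = Matrix.single i j 1 := by
    intro i j
    simp only [Fintype.sum_prod_type, c, ite_smul, zero_smul]
    rw [Finset.sum_eq_single i (by intro b _ hb; simp [hb.symm]) (by simp),
      Finset.sum_eq_single j (by intro b _ hb; simp [hb.symm]) (by simp)]
    by_cases h : i = j
    · subst h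
      ext a b
      simp only [Fin.sum_univ_four, Matrix.add_apply, Matrix.smul_apply, vecMulVec_apply, ψ, n, w,
        if_true, Matrix.single_apply, Pi.single_apply, Pi.star_apply, smul_eq_mul]
      have q1 : (if i = a ∧ i = b then (1 : ℂ) else 0)
          = (if a = i then 1 else 0) * (if b = i then 1 else 0) := by
        split_ifs <;> first | grind | simp_all
      rw [q1]
      split_ifs <;> simp <;> norm_num
    · have h' : ¬ j = i := fun e => h e.symm
      have e2 : Complex.I ^ 2 = -1 := Complex.I_sq
      have e3 : Complex.I ^ 3 = -Complex.I := by rw [pow_succ, e2]; ring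
      ext a b
      simp only [Fin.sum_univ_four, Matrix.add_apply, Matrix.smul_apply, vecMulVec_apply, ψ, n, w,
        h, if_false, if_true, Matrix.single_apply, Pi.single_apply, Pi.star_apply, Pi.add_apply,
        Pi.smul_apply, smul_eq_mul]
      have v0 : ((0 : Fin 4) : ℕ) = 0 := rfl
      have v1 : ((1 : Fin 4) : ℕ) = 1 := rfl
      have v2 : ((2 : Fin 4) : ℕ) = 2 := rfl
      have v3 : ((3 : Fin 4) : ℕ) = 3 := rfl
      rw [v0, v1, v2, v3, e2, e3, pow_zero, pow_one]
      have q1 : (if i = a ∧ j = b then (1 : ℂ) else 0)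
          = (if a = i then 1 else 0) * (if b = j then 1 else 0) := by
        split_ifs <;> first | grind | simp_all
      rw [q1]
      have q2 : ∀ p : Prop, ∀ _ : Decidable p, star (if p then (1 : ℂ) else 0) = if p then 1 else 0 := by
        intro p _; split_ifs <;> simp
      simp only [star_add, star_mul', q2, star_neg, star_one]
      have eI : star Complex.I = -Complex.I := Complex.conj_I
      rw [eI]
      push_cast
      ring_nf
      simp only [e2, e3, Complex.I_pow_four]
      ring
  let e := (Fintype.equivFin (Fin d × Fin d × Fin 4)).symm
  refine ⟨_, fun s => ψ (e s), fun i j s => c i j (e s), fun s => hψ _, fun i j => ?_⟩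
  rw [← hc i j]
  exact Equiv.sum_comp e (fun x => c i j x • ψ x)

lemma aux_decomp (dA dB : ℕ) (M : Matrix (Fin dA × Fin dB) (Fin dA × Fin dB) ℂ)
    (hM : M.IsHermitian) : ∃ (S T : ℕ) (ψ : Fin S → Matrix (Fin dA) (Fin dA) ℂ)
      (φ : Fin T → Matrix (Fin dB) (Fin dB) ℂ) (β : Fin S → Fin T → ℝ),
      (∀ s, RankOneProj (ψ s)) ∧ (∀ t, RankOneProj (φ t)) ∧
      ∀ a b a' b', ∑ s, ∑ t, (β s t : ℂ) * (ψ s a a' * φ t b b') = M (a, b) (a', b') := by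
  obtain ⟨S, ψ, c, hψ, hc⟩ := aux_span dA
  obtain ⟨T, φ, e, hφ, he⟩ := aux_span dB
  let γ : Fin S → Fin T → ℂ := fun s t =>
    ∑ x : (Fin dA × Fin dA) × (Fin dB × Fin dB),
      M (x.1.1, x.2.1) (x.1.2, x.2.2) * (c x.1.1 x.1.2 s * e x.2.1 x.2.2 t)
  have hγ : ∀ a b a' b', ∑ s, ∑ t, γ s t * (ψ s a a' * φ t b b') = M (a, b) (a', b') := by
    intro a b a' b'
    have h1 : ∀ i j, ∑ s, c i j s * ψ s a a' = Matrix.single i j (1 : ℂ) a a' := by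
      intro i j
      rw [← hc i j]; simp [Matrix.sum_apply]
    have h2 : ∀ i j, ∑ s, e i j s * φ s b b' = Matrix.single i j (1 : ℂ) b b' := by
      intro i j
      rw [← he i j]; simp [Matrix.sum_apply]
    calc _ = ∑ s, ∑ t, ∑ x : (Fin dA × Fin dA) × (Fin dB × Fin dB), M (x.1.1, x.2.1) (x.1.2, x.2.2) *
          ((c x.1.1 x.1.2 s * ψ s a a') * (e x.2.1 x.2.2 t * φ t b b')) := by
          simp only [γ, Finset.sum_mul]
          congr! 3
          ring
      _ = ∑ x : (Fin dA × Fin dA) × (Fin dB × Fin dB), ∑ s, ∑ t, M (x.1.1, x.2.1) (x.1.2, x.2.2) *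
          ((c x.1.1 x.1.2 s * ψ s a a') * (e x.2.1 x.2.2 t * φ t b b')) := by
          rw [Finset.sum_comm (s := (Finset.univ : Finset ((Fin dA × Fin dA) × (Fin dB × Fin dB))))]
          exact Finset.sum_congr rfl fun s _ => Finset.sum_comm
      _ = ∑ x : (Fin dA × Fin dA) × (Fin dB × Fin dB), M (x.1.1, x.2.1) (x.1.2, x.2.2) *
          (Matrix.single x.1.1 x.1.2 (1 : ℂ) a a' * Matrix.single x.2.1 x.2.2 (1 : ℂ) b b') := by
          refine Finset.sum_congr rfl fun x _ => ?_
          rw [← h1, ← h2, Finset.sum_mul_sum, Finset.mul_sum]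
          simp only [Finset.mul_sum]
      _ = _ := by
          simp [Fintype.sum_prod_type, Matrix.single_apply, ite_and]
  refine ⟨S, T, ψ, φ, fun s t => (γ s t).re, hψ, hφ, fun a b a' b' => ?_⟩
  have h3 := hγ a b a' b'
  have h4 := congrArg star (hγ a' b' a b)
  rw [← Matrix.conjTranspose_apply, hM.eq] at h4
  have h5 : ∀ s, star (ψ s a' a) = ψ s a a' := fun s => (hψ s).1.apply _ _
  have h6 : ∀ t, star (φ t b' b) = φ t b b' := fun t => (hφ t).1.apply _ _
  simp only [star_sum, star_mul', h5, h6] at h4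
  have : ∀ s t, ((γ s t).re : ℂ) = (γ s t + star (γ s t)) / 2 := by
    intro s t
    rw [Complex.re_eq_add_conj]; rfl
  simp only [this]
  calc _ = ((∑ s, ∑ t, γ s t * (ψ s a a' * φ t b b'))
        + ∑ s, ∑ t, star (γ s t) * (ψ s a a' * φ t b b')) / 2 := by
        simp only [← Finset.sum_add_distrib, Finset.sum_div]
        congr! 2
        ring
    _ = _ := by rw [h3, h4]; ring

def Yar {dA dB : ℕ} (X M : Matrix (Fin dA × Fin dB) (Fin dA × Fin dB) ℂ) :
    Matrix ((Fin dA × Fin dA) × (Fin dB × Fin dB)) ((Fin dA × Fin dA) × (Fin dB × Fin dB)) ℂ :=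
  (X ⊗ₖ M).submatrix (fun x => ((x.1.1, x.2.1), (x.1.2, x.2.2)))
    (fun x => ((x.1.1, x.2.1), (x.1.2, x.2.2)))

lemma aux_sum {dA dB S T : ℕ} (M X : Matrix (Fin dA × Fin dB) (Fin dA × Fin dB) ℂ)
    (ψ : Fin S → Matrix (Fin dA) (Fin dA) ℂ)
    (φ : Fin T → Matrix (Fin dB) (Fin dB) ℂ) (β : Fin S → Fin T → ℝ)
    (h : ∀ a b a' b', ∑ s, ∑ t, (β s t : ℂ) * (ψ s a a' * φ t b b') = M (a, b) (a', b'))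
    (Q : Matrix ((Fin dA × Fin dA) × (Fin dB × Fin dB)) ((Fin dA × Fin dA) × (Fin dB × Fin dB)) ℂ) :
    ∑ s, ∑ t, (β s t : ℂ) * (Q * Zar (ψ s) X (φ t)).trace = (Q * Yar X M).trace := by
  have : Yar X M = ∑ s, ∑ t, (β s t : ℂ) • Zar (ψ s) X (φ t) := by
    ext x y
    simp only [Yar, Zar, submatrix_apply, kroneckerMap_apply, ← h, Matrix.sum_apply,
      Matrix.smul_apply, of_apply, Finset.mul_sum, smul_eq_mul]
    congr! 2
    ring
  rw [this]
  simp [Matrix.mul_sum, trace_sum]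

noncomputable def Phi (d : ℕ) : Matrix (Fin d × Fin d) (Fin d × Fin d) ℂ :=
  ((d : ℝ) : ℂ)⁻¹ • vecMulVec (fun x => if x.1 = x.2 then 1 else 0)
    (star (fun x => if x.1 = x.2 then 1 else 0))

lemma Phi_effect (d : ℕ) (hd : d ≠ 0) : IsEffect (Phi d) := by
  have := aux_proj (fun x : Fin d × Fin d => if x.1 = x.2 then (1 : ℂ) else 0) d
    (by exact_mod_cast hd) (by simp [dotProduct, Fintype.sum_prod_type])
  exact aux_effect _ this.1 this.2.1

lemma aux_Phi {dA dB : ℕ} (X M : Matrix (Fin dA × Fin dB) (Fin dA × Fin dB) ℂ) :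
    ((Phi dA ⊗ₖ Phi dB) * Yar X M).trace
      = ((((dA : ℝ)⁻¹ * (dB : ℝ)⁻¹ : ℝ)) : ℂ) * ∑ p, ∑ q, X p q * M p q := by
  have key : ∀ x y : (Fin dA × Fin dA) × (Fin dB × Fin dB), (Phi dA ⊗ₖ Phi dB) x y =
      (dA : ℂ)⁻¹ * (dB : ℂ)⁻¹ * (if x.1.1 = x.1.2 then if x.2.1 = x.2.2 then
        if y.1.1 = y.1.2 then if y.2.1 = y.2.2 then 1 else 0 else 0 else 0 else 0) := by
    rintro ⟨⟨a, b⟩, ⟨c, d⟩⟩ ⟨⟨a', b'⟩, ⟨c', d'⟩⟩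
    simp only [Phi, kroneckerMap_apply, Matrix.smul_apply, vecMulVec_apply, Pi.star_apply]
    split_ifs <;> simp
  simp only [trace, diag_apply, mul_apply, key]
  rw [Finset.sum_comm]
  simp [Fintype.sum_prod_type, Yar, Finset.mul_sum]

/-- Theorem 1, bipartite: every Hermitian unit-trace POPT state W that is not
positive semidefinite admits a semiquantum game — quantum inputs ψ_s, φ_t (rank-one
projections), real payoff coefficients β_{s,t}, and local effects π_A, π_B — whose payoff is
negative on W but nonnegative on every quantum state ρ for all local effects. -/
theorem stmt6 {dA dB : ℕ} (W : Matrix (Fin dA × Fin dB) (Fin dA × Fin dB) ℂ)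
    (hHerm : W.IsHermitian) (hTr : W.trace = 1)
    (hPOPT : ∀ (A : Matrix (Fin dA) (Fin dA) ℂ) (B : Matrix (Fin dB) (Fin dB) ℂ),
      A.PosSemidef → B.PosSemidef →
      0 ≤ ((W * (A ⊗ₖ B)).trace).re ∧ ((W * (A ⊗ₖ B)).trace).im = 0)
    (hNotPSD : ¬ W.PosSemidef) :
    ∃ (S T : ℕ) (ψ : Fin S → Matrix (Fin dA) (Fin dA) ℂ)
      (φ : Fin T → Matrix (Fin dB) (Fin dB) ℂ) (β : Fin S → Fin T → ℝ)
      (πA : Matrix (Fin dA × Fin dA) (Fin dA × Fin dA) ℂ)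
      (πB : Matrix (Fin dB × Fin dB) (Fin dB × Fin dB) ℂ),
      (∀ s, RankOneProj (ψ s)) ∧ (∀ t, RankOneProj (φ t)) ∧
      IsEffect πA ∧ IsEffect πB ∧
      ((∑ s, ∑ t, (β s t : ℂ) * ((πA ⊗ₖ πB) * Zar (ψ s) W (φ t)).trace).re < 0 ∧
       (∑ s, ∑ t, (β s t : ℂ) * ((πA ⊗ₖ πB) * Zar (ψ s) W (φ t)).trace).im = 0) ∧
      (∀ (ρ : Matrix (Fin dA × Fin dB) (Fin dA × Fin dB) ℂ),
        ρ.PosSemidef → ρ.trace = 1 →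
        ∀ (πA' : Matrix (Fin dA × Fin dA) (Fin dA × Fin dA) ℂ)
          (πB' : Matrix (Fin dB × Fin dB) (Fin dB × Fin dB) ℂ),
          IsEffect πA' → IsEffect πB' →
          0 ≤ (∑ s, ∑ t, (β s t : ℂ) * ((πA' ⊗ₖ πB') * Zar (ψ s) ρ (φ t)).trace).re ∧
          (∑ s, ∑ t, (β s t : ℂ) * ((πA' ⊗ₖ πB') * Zar (ψ s) ρ (φ t)).trace).im = 0) := by
  have hdA : dA ≠ 0 := by
    rintro rfl
    simp [trace] at hTr
  have hdB : dB ≠ 0 := by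
    rintro rfl
    simp [trace] at hTr
  obtain ⟨v, hv⟩ : ∃ v, ¬ 0 ≤ star v ⬝ᵥ (W *ᵥ v) := by
    by_contra! h
    exact hNotPSD (PosSemidef.of_dotProduct_mulVec_nonneg hHerm h)
  have him : (star v ⬝ᵥ (W *ᵥ v)).im = 0 := hHerm.im_star_dotProduct_mulVec_self v
  have hre : (star v ⬝ᵥ (W *ᵥ v)).re < 0 := by
    by_contra! h
    exact hv (Complex.nonneg_iff.2 ⟨h, him.symm⟩)
  have hM : (vecMulVec (star v) v).PosSemidef := posSemidef_vecMulVec_star_self v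
  obtain ⟨S, T, ψ, φ, β, hψ, hφ, h⟩ := aux_decomp dA dB _ hM.1
  refine ⟨S, T, ψ, φ, β, Phi dA, Phi dB, hψ, hφ, Phi_effect _ hdA, Phi_effect _ hdB, ?_, ?_⟩
  · rw [aux_sum _ W ψ φ β h, aux_Phi]
    have : ∑ p, ∑ q, W p q * vecMulVec (star v) v p q = star v ⬝ᵥ (W *ᵥ v) := by
      simp only [dotProduct, mulVec, Finset.mul_sum, vecMulVec_apply]
      congr! 2
      ring
    rw [this, Complex.re_ofReal_mul, Complex.im_ofReal_mul, him]
    have : (0 : ℝ) < (dA : ℝ)⁻¹ * (dB : ℝ)⁻¹ := by positivity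
    exact ⟨mul_neg_of_pos_of_neg this hre, mul_zero _⟩
  · intro ρ hρ _ πA' πB' hA hB
    rw [aux_sum _ ρ ψ φ β h]
    have := aux_trace (hA.1.kronecker hB.1) (((hρ.kronecker hM).submatrix _ : (Yar ρ _).PosSemidef))
    have := Complex.nonneg_iff.1 this
    exact ⟨this.1, this.2.symm⟩
end

section
/- (Theorem 2, multipartite.) Fix n ≥ 1 and dimensions d₁,…,d_n. Let W be a Hermitian unit-trace matrix indexed by Π_{i} Fin d_i that is multipartite-POPT but not positive semidefinite. Then there exist finite index sets S₁,…,S_n, rank-one projections ψ_{i,s} on ℂ^{d_i} for each i and s ∈ S_i, real coefficients β indexed by S₁×…×S_n, and matrices π_i indexed by Fin d_i × Fin d_i with 0 ≤ π_i ≤ I, such that: (i) Σ_{s₁,…,s_n} β_{s₁…s_n} · Tr[(⊗_i π_i) · Z(W; ψ_{1,s₁},…,ψ_{n,s_n})] < 0; and (ii) for every positive semidefinite unit-trace ρ indexed by Π_i Fin d_i and all matrices π'_i with 0 ≤ π'_i ≤ I: Σ_{s₁,…,s_n} β_{s₁…s_n} · Tr[(⊗_i π'_i) · Z(ρ; ψ_{1,s₁},…,ψ_{n,s_n})]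 ≥ 0. -/
open Matrix ComplexOrder

/-- The product effect ⊗_i E_i, with entries Π_i E_i (x i) (y i). -/
def prodEff {n : ℕ} {α : Fin n → Type} [∀ i, Fintype (α i)] [∀ i, DecidableEq (α i)]
    (E : ∀ i, Matrix (α i) (α i) ℂ) : Matrix (∀ i, α i) (∀ i, α i) ℂ :=
  Matrix.of fun x y => ∏ i, E i (x i) (y i)

/-- Multipartite POPT: Tr[W·E] ≥ 0 (a nonnegative real) for every product effect E built
from positive semidefinite local operators. -/
def MultiPOPT {n : ℕ} {d : Fin n → ℕ}
    (W : Matrix (∀ i, Fin (d i)) (∀ i, Fin (d i)) ℂ) : Prop :=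
  ∀ E : ∀ i, Matrix (Fin (d i)) (Fin (d i)) ℂ, (∀ i, (E i).PosSemidef) →
    0 ≤ ((W * prodEff E).trace).re ∧ ((W * prodEff E).trace).im = 0

/-- The multipartite semiquantum arrangement Z(X; ψ₁,…,ψ_n), where the i-th party holds the
pair (A_i, A_i°): Z x y = X (fun i => (x i).1) (fun i => (y i).1) · Π_i ψ_i (x i).2 (y i).2. -/
def ZarMulti {n : ℕ} {d : Fin n → ℕ}
    (X : Matrix (∀ i, Fin (d i)) (∀ i, Fin (d i)) ℂ)
    (ψ : ∀ i, Matrix (Fin (d i)) (Fin (d i)) ℂ) :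
    Matrix (∀ i, Fin (d i) × Fin (d i)) (∀ i, Fin (d i) × Fin (d i)) ℂ :=
  Matrix.of fun x y =>
    X (fun i => (x i).1) (fun i => (y i).1) * ∏ i, ψ i (x i).2 (y i).2

lemma aux_decomp_s7 {α : Type} [Fintype α] [DecidableEq α] (A : Matrix α α ℂ)
    (hA : A.PosSemidef) : ∃ B : Matrix α α ℂ, A = Bᴴ * B := by
  open scoped MatrixOrder in
  exact CStarAlgebra.nonneg_iff_eq_star_mul_self.mp (Matrix.nonneg_iff_posSemidef.mpr hA)

lemma aux_vmv_mem {d : ℕ} (w : Fin d → ℂ) :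
    vecMulVec w (star w) ∈ Submodule.span ℂ {P : Matrix (Fin d) (Fin d) ℂ | RankOneProj P} := by
  by_cases hw : w = 0
  · subst hw; simp
  have hc : star w ⬝ᵥ w ≠ 0 := by
    rwa [Ne, dotProduct_star_self_eq_zero]
  have hstar : star (star w ⬝ᵥ w) = star w ⬝ᵥ w := by
    simp [dotProduct, mul_comm]
  generalize hcc : star w ⬝ᵥ w = c at *
  have h1 : vecMulVec w (star w) = c • (c⁻¹ • vecMulVec w (star w)) := by
    rw [smul_smul, mul_inv_cancel₀ hc, one_smul]
  rw [h1]
  refine Submodule.smul_mem _ _ (Submodule.subset_span ⟨?_, ?_, ?_⟩)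
  · rw [Matrix.IsHermitian, conjTranspose_smul, star_inv₀, hstar,
      (posSemidef_vecMulVec_self_star w).1]
  · rw [smul_mul_smul_comm, vecMulVec_mul_vecMulVec, hcc]
    ext i j
    simp [vecMulVec_apply]
    field_simp
  · rw [trace_smul, trace_vecMulVec, dotProduct_comm, hcc, smul_eq_mul, inv_mul_cancel₀ hc]

lemma aux_span_s7 {d : ℕ} :
    ⊤ ≤ Submodule.span ℂ {P : Matrix (Fin d) (Fin d) ℂ | RankOneProj P} := by
  intro M _
  rw [matrix_eq_sum_single M]
  refine Submodule.sum_mem _ fun a _ => Submodule.sum_mem _ fun b _ => ?_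
  have key : Matrix.single a b (M a b) = M a b •
      (vecMulVec (Pi.single a 1 + Pi.single b 1) (star (Pi.single a 1 + Pi.single b 1))
       + Complex.I • vecMulVec (Pi.single a 1 + Complex.I • Pi.single b 1)
          (star (Pi.single a 1 + Complex.I • Pi.single b 1))
       - (1 + Complex.I) • (vecMulVec (Pi.single a 1) (star (Pi.single a 1))
        + vecMulVec (Pi.single b 1) (star (Pi.single b 1)))) * (1/2 : ℂ) • (1 : Matrix (Fin d) (Fin d) ℂ) := by
    ext i j
    have : ∀ k : Fin d, (starRingEnd ℂ) ((Pi.single k 1 : Fin d → ℂ) j) = (Pi.single k 1 : Fin d → ℂ) j := by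
      intro k
      by_cases h : j = k <;> simp [Pi.single_apply, h]
    have h2 : Matrix.single a b (M a b) i j = M a b * (Pi.single a 1 : Fin d → ℂ) i * (Pi.single b 1 : Fin d → ℂ) j := by
      simp [Matrix.single_apply, Pi.single_apply, eq_comm, ite_and]
      split_ifs <;> rfl
    rw [h2]
    simp [vecMulVec_apply, this]
    generalize (Pi.single a 1 : Fin d → ℂ) i = p
    generalize (Pi.single a 1 : Fin d → ℂ) j = q
    generalize (Pi.single b 1 : Fin d → ℂ) i = r
    generalize (Pi.single b 1 : Fin d → ℂ) j = t
    have hI := Complex.I_sq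
    grind
  rw [key, mul_smul_comm, mul_one]
  refine Submodule.smul_mem _ _ (Submodule.smul_mem _ _ (Submodule.sub_mem _ (Submodule.add_mem _ ?_ ?_) ?_))
  · exact aux_vmv_mem _
  · exact Submodule.smul_mem _ _ (aux_vmv_mem _)
  · exact Submodule.smul_mem _ _ (Submodule.add_mem _ (aux_vmv_mem _) (aux_vmv_mem _))

lemma aux_basis (d : ℕ) : ∃ (S : ℕ) (ψ : Fin S → Matrix (Fin d) (Fin d) ℂ)
    (c : Fin d → Fin d → Fin S → ℂ), (∀ s, RankOneProj (ψ s)) ∧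
    ∀ a b x y, (Matrix.single a b (1:ℂ)) x y = ∑ s, c a b s * ψ s x y := by
  let b := Module.Basis.ofSpan (aux_span_s7 (d := d))
  have hfin := Module.Finite.finite_basis b
  let e := @Finite.equivFin _ hfin
  let b' := b.reindex e
  refine ⟨_, fun s => b' s, fun x y s => b'.repr (Matrix.single x y 1) s, ?_, ?_⟩
  · intro s
    apply Module.Basis.ofSpan_subset (aux_span_s7 (d := d))
    exact ⟨e.symm s, (Module.Basis.reindex_apply b e s).symm⟩
  · intro p q x y
    conv_lhs => rw [← b'.sum_repr (Matrix.single p q (1:ℂ))]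
    simp [Matrix.sum_apply]

lemma aux_prodEff_psd {n : ℕ} {α : Fin n → Type} [∀ i, Fintype (α i)] [∀ i, DecidableEq (α i)]
    (E : ∀ i, Matrix (α i) (α i) ℂ) (h : ∀ i, (E i).PosSemidef) : (prodEff E).PosSemidef := by
  have h' : ∀ i, ∃ B : Matrix (α i) (α i) ℂ, E i = Bᴴ * B := fun i =>
    aux_decomp_s7 _ (h i)
  choose B hB using h'
  have : prodEff E = (prodEff B)ᴴ * prodEff B := by
    ext x y
    simp only [prodEff, Matrix.mul_apply, Matrix.of_apply, hB, conjTranspose_apply, star_prod,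
      Finset.prod_univ_sum, Fintype.piFinset_univ, Finset.prod_mul_distrib]
  rw [this]
  exact posSemidef_conjTranspose_mul_self _

def auxZ {n : ℕ} {d : Fin n → ℕ}
    (X M : Matrix (∀ i, Fin (d i)) (∀ i, Fin (d i)) ℂ) :
    Matrix (∀ i, Fin (d i) × Fin (d i)) (∀ i, Fin (d i) × Fin (d i)) ℂ :=
  Matrix.of fun x y => X (fun i => (x i).1) (fun i => (y i).1) * M (fun i => (x i).2) (fun i => (y i).2)

lemma auxZ_psd {n : ℕ} {d : Fin n → ℕ}
    (X M : Matrix (∀ i, Fin (d i)) (∀ i, Fin (d i)) ℂ) (hX : X.PosSemidef) (hM : M.PosSemidef) :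
    (auxZ X M).PosSemidef :=
  (hX.kronecker hM).submatrix (fun x : (∀ i, Fin (d i) × Fin (d i)) => ((fun i => (x i).1), (fun i => (x i).2)))

lemma aux_expand {n : ℕ} {d : Fin n → ℕ} (S : Fin n → ℕ)
    (ψ : ∀ i, Fin (S i) → Matrix (Fin (d i)) (Fin (d i)) ℂ)
    (c : ∀ i, Fin (d i) → Fin (d i) → Fin (S i) → ℂ)
    (hψ : ∀ i s, RankOneProj (ψ i s))
    (hc : ∀ i a b x y, (Matrix.single a b (1:ℂ)) x y = ∑ s, c i a b s * ψ i s x y)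
    (M : Matrix (∀ i, Fin (d i)) (∀ i, Fin (d i)) ℂ) (hM : M.IsHermitian) :
    ∃ β : (∀ i, Fin (S i)) → ℝ, ∀ x y, M x y = ∑ s, (β s : ℂ) * ∏ i, ψ i (s i) (x i) (y i) := by
  let γ : (∀ i, Fin (S i)) → ℂ := fun s => ∑ p, ∑ q, M p q * ∏ i, c i (p i) (q i) (s i)
  have hγ : ∀ x y, M x y = ∑ s, γ s * ∏ i, ψ i (s i) (x i) (y i) := by
    intro x y
    have h1 : ∀ p q : (∀ i, Fin (d i)), ∑ s : (∀ i, Fin (S i)), ∏ i, (c i (p i) (q i) (s i) * ψ i (s i) (x i) (y i))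
        = if p = x ∧ q = y then 1 else 0 := by
      intro p q
      have := Finset.prod_univ_sum (fun i => (Finset.univ : Finset (Fin (S i))))
        (fun i s => c i (p i) (q i) s * ψ i s (x i) (y i))
      rw [Fintype.piFinset_univ] at this
      rw [← this]
      simp_rw [← hc, Matrix.single_apply]
      rw [Finset.prod_ite_zero]
      simp [funext_iff, forall_and]
    simp only [γ, Finset.sum_mul]
    rw [Finset.sum_comm]
    simp_rw [Finset.sum_comm (s := (Finset.univ : Finset (∀ i, Fin (S i)))), mul_assoc,
      ← Finset.prod_mul_distrib, ← Finset.mul_sum, h1]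
    simp [ite_and]
  refine ⟨fun s => (γ s).re, fun x y => ?_⟩
  have h2 : M x y = ∑ s, star (γ s) * ∏ i, ψ i (s i) (x i) (y i) := by
    conv_lhs => rw [← hM]
    rw [conjTranspose_apply, hγ y x, star_sum]
    refine Finset.sum_congr rfl fun s _ => ?_
    rw [star_mul', star_prod]
    congr 1
    refine Finset.prod_congr rfl fun i _ => ?_
    rw [← conjTranspose_apply, (hψ i (s i)).1]
  have h3 : M x y = (M x y + M x y) / 2 := by ring
  rw [h3]
  nth_rw 1 [hγ x y]
  rw [h2, ← Finset.sum_add_distrib, Finset.sum_div]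
  refine Finset.sum_congr rfl fun s _ => ?_
  rw [Complex.re_eq_add_conj, ← add_mul]
  simp only [← starRingEnd_apply]
  ring

lemma aux_sum_s7 {n : ℕ} {d : Fin n → ℕ} (S : Fin n → ℕ)
    (ψ : ∀ i, Fin (S i) → Matrix (Fin (d i)) (Fin (d i)) ℂ)
    (M X : Matrix (∀ i, Fin (d i)) (∀ i, Fin (d i)) ℂ) (β : (∀ i, Fin (S i)) → ℝ)
    (hβ : ∀ x y, M x y = ∑ s, (β s : ℂ) * ∏ i, ψ i (s i) (x i) (y i))
    (P : Matrix (∀ i, Fin (d i) × Fin (d i)) (∀ i, Fin (d i) × Fin (d i)) ℂ) :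
    ∑ s : ∀ i, Fin (S i), (β s : ℂ) * (P * ZarMulti X (fun i => ψ i (s i))).trace
      = (P * auxZ X M).trace := by
  have : auxZ X M = ∑ s : ∀ i, Fin (S i), (β s : ℂ) • ZarMulti X (fun i => ψ i (s i)) := by
    ext x y
    simp only [auxZ, ZarMulti, Matrix.of_apply, Matrix.sum_apply, Matrix.smul_apply, hβ,
      Finset.mul_sum, smul_eq_mul]
    exact Finset.sum_congr rfl fun s _ => by ring
  rw [this, Finset.mul_sum, trace_sum]
  simp

lemma aux_trace_s7 {α : Type} [Fintype α] [DecidableEq α] (A C : Matrix α α ℂ)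
    (hA : A.PosSemidef) (hC : C.PosSemidef) : 0 ≤ (A * C).trace := by
  obtain ⟨B, rfl⟩ : ∃ B : Matrix α α ℂ, A = Bᴴ * B := aux_decomp_s7 A hA
  rw [Matrix.mul_assoc, trace_mul_comm]
  exact (hC.mul_mul_conjTranspose_same B).trace_nonneg

noncomputable def auxPi (d : ℕ) : Matrix (Fin d × Fin d) (Fin d × Fin d) ℂ :=
  Matrix.of fun x y => if x.1 = x.2 ∧ y.1 = y.2 then (d : ℂ)⁻¹ else 0

lemma auxPi_effect (d : ℕ) (hd : d ≠ 0) : IsEffect (auxPi d) := by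
  have hH : (auxPi d)ᴴ = auxPi d := by
    ext x y
    simp only [auxPi, conjTranspose_apply, Matrix.of_apply, and_comm]
    split_ifs <;> simp
  have hP : auxPi d * auxPi d = auxPi d := by
    ext x y
    simp only [auxPi, Matrix.mul_apply, Matrix.of_apply, Fintype.sum_prod_type]
    have hd' : (d : ℂ) ≠ 0 := by exact_mod_cast hd
    by_cases hx : x.1 = x.2 <;> by_cases hy : y.1 = y.2 <;> simp [hx, hy, hd']
  refine ⟨?_, ?_⟩
  · have := posSemidef_conjTranspose_mul_self (auxPi d)
    rwa [hH, hP] at this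
  · have := posSemidef_conjTranspose_mul_self (1 - auxPi d)
    rwa [conjTranspose_sub, conjTranspose_one, hH, sub_mul, one_mul, mul_sub, hP, mul_one, sub_self, sub_zero] at this

lemma aux_pi_trace {n : ℕ} {d : Fin n → ℕ}
    (X M : Matrix (∀ i, Fin (d i)) (∀ i, Fin (d i)) ℂ) :
    (prodEff (fun i => auxPi (d i)) * auxZ X M).trace
      = (∏ i, (d i : ℂ)⁻¹) * ∑ q, ∑ p, X q p * M q p := by
  let e : ((∀ i, Fin (d i)) × (∀ i, Fin (d i))) ≃ (∀ i, Fin (d i) × Fin (d i)) :=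
    { toFun := fun z i => (z.1 i, z.2 i)
      invFun := fun x => (fun i => (x i).1, fun i => (x i).2)
      left_inv := fun z => rfl
      right_inv := fun x => rfl }
  have h : ∀ z w, prodEff (fun i => auxPi (d i)) (e z) (e w) =
      if z.1 = z.2 then (if w.1 = w.2 then ∏ i, (d i : ℂ)⁻¹ else 0) else 0 := by
    intro z w
    simp only [prodEff, auxPi, Matrix.of_apply, e, Equiv.coe_fn_mk]
    rw [Finset.prod_ite_zero]
    simp [forall_and, funext_iff, ite_and]
  have h' : ∀ z w, auxZ X M (e z) (e w) = X z.1 w.1 * M z.2 w.2 := fun z w => rfl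
  simp only [trace, diag, Matrix.mul_apply]
  simp_rw [← e.sum_comp, h, h', Fintype.sum_prod_type]
  simp only [ite_mul, zero_mul, Finset.sum_ite_irrel, Finset.sum_const_zero, Finset.sum_ite_eq, Finset.mem_univ, if_true]
  rw [Finset.sum_comm, Finset.mul_sum]
  simp only [Finset.mul_sum]

/-- Theorem 2, multipartite: every Hermitian unit-trace multipartite-POPT
state W that is not positive semidefinite admits a semiquantum game — quantum inputs
ψ_{i,s} (rank-one projections), real payoff coefficients β, and local effects π_i —
whose payoff is negative on W but nonnegative on every quantum state ρ for all effects. -/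
theorem stmt7 (n : ℕ) (hn : 1 ≤ n) (d : Fin n → ℕ)
    (W : Matrix (∀ i, Fin (d i)) (∀ i, Fin (d i)) ℂ)
    (hHerm : W.IsHermitian) (hTr : W.trace = 1)
    (hPOPT : MultiPOPT W) (hNotPSD : ¬ W.PosSemidef) :
    ∃ (S : Fin n → ℕ)
      (ψ : ∀ i, Fin (S i) → Matrix (Fin (d i)) (Fin (d i)) ℂ)
      (β : (∀ i, Fin (S i)) → ℝ)
      (π : ∀ i, Matrix (Fin (d i) × Fin (d i)) (Fin (d i) × Fin (d i)) ℂ),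
      (∀ i s, RankOneProj (ψ i s)) ∧ (∀ i, IsEffect (π i)) ∧
      ((∑ s : ∀ i, Fin (S i), (β s : ℂ) *
          (prodEff π * ZarMulti W (fun i => ψ i (s i))).trace).re < 0 ∧
       (∑ s : ∀ i, Fin (S i), (β s : ℂ) *
          (prodEff π * ZarMulti W (fun i => ψ i (s i))).trace).im = 0) ∧
      (∀ (ρ : Matrix (∀ i, Fin (d i)) (∀ i, Fin (d i)) ℂ),
        ρ.PosSemidef → ρ.trace = 1 →
        ∀ (π' : ∀ i, Matrix (Fin (d i) × Fin (d i)) (Fin (d i) × Fin (d i)) ℂ),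
          (∀ i, IsEffect (π' i)) →
          0 ≤ (∑ s : ∀ i, Fin (S i), (β s : ℂ) *
                (prodEff π' * ZarMulti ρ (fun i => ψ i (s i))).trace).re ∧
          (∑ s : ∀ i, Fin (S i), (β s : ℂ) *
                (prodEff π' * ZarMulti ρ (fun i => ψ i (s i))).trace).im = 0) := by
  have hd : ∀ i, d i ≠ 0 := by
    intro i hi
    have : IsEmpty (∀ i, Fin (d i)) := ⟨fun x => by have := (x i).2; omega⟩
    rw [trace, Finset.univ_eq_empty, Finset.sum_empty] at hTr
    exact zero_ne_one hTr
  obtain ⟨v, hv⟩ : ∃ v, ¬ 0 ≤ star v ⬝ᵥ (W *ᵥ v) := by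
    by_contra! hcon
    exact hNotPSD (PosSemidef.of_dotProduct_mulVec_nonneg hHerm hcon)
  have him : (star v ⬝ᵥ (W *ᵥ v)).im = 0 := hHerm.im_star_dotProduct_mulVec_self v
  have hre : (star v ⬝ᵥ (W *ᵥ v)).re < 0 := by
    by_contra! hcon
    exact hv (Complex.nonneg_iff.mpr ⟨hcon, him.symm⟩)
  have hM : (vecMulVec (star v) v).PosSemidef := by
    have := posSemidef_vecMulVec_self_star (star v)
    rwa [star_star] at this
  choose S ψ c hψ hc using fun i => aux_basis (d i)
  obtain ⟨β, hβ⟩ := aux_expand S ψ c hψ hc _ hM.1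
  refine ⟨S, ψ, β, fun i => auxPi (d i), hψ, fun i => auxPi_effect _ (hd i), ?_, ?_⟩
  · rw [aux_sum_s7 S ψ _ W β hβ, aux_pi_trace]
    have h1 : ∑ q, ∑ p, W q p * vecMulVec (star v) v q p = star v ⬝ᵥ (W *ᵥ v) := by
      simp only [dotProduct, mulVec, vecMulVec_apply, Finset.mul_sum]
      exact Finset.sum_congr rfl fun q _ => Finset.sum_congr rfl fun p _ => by ring
    have h2 : (∏ i, (d i : ℂ)⁻¹) = ((∏ i, (d i : ℝ)⁻¹ : ℝ) : ℂ) := by push_cast; rfl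
    have h3 : 0 < ∏ i, (d i : ℝ)⁻¹ := Finset.prod_pos fun i _ =>
      inv_pos.mpr (by exact_mod_cast Nat.pos_of_ne_zero (hd i))
    rw [h1, h2, Complex.re_ofReal_mul, Complex.im_ofReal_mul, him, mul_zero]
    exact ⟨mul_neg_of_pos_of_neg h3 hre, rfl⟩
  · intro ρ hρ _ π' hπ'
    rw [aux_sum_s7 S ψ _ ρ β hβ]
    have := aux_trace_s7 _ _ (aux_prodEff_psd π' fun i => (hπ' i).1) (auxZ_psd ρ _ hρ hM)
    rw [Complex.nonneg_iff] at this
    exact ⟨this.1, this.2.symm⟩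
end

section
/- (Proposition A1.) Fix n ≥ 1 and dimensions d₁,…,d_n and e₁,…,e_n. Let W be a multipartite-POPT matrix indexed by Π_i Fin d_i, and for each i let ψ_i be a rank-one projection on ℂ^{e_i}. Then the tensor product Z indexed by Π_i (Fin d_i × Fin e_i) with entries Z x y = W (fun i => (x i).1) (fun i => (y i).1) · Π_i ψ_i (x i).2 (y i).2 is again multipartite-POPT with respect to the n local pairs: for all positive semidefinite matrices π_i indexed by Fin d_i × Fin e_i, Tr[Z · E] ≥ 0, where E x y = Π_i π_i (x i) (y i). -/
open Matrix ComplexOrder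

/-- The tensor product of a multipartite state W (local dimensions d_i) with quantum
inputs ψ_i (local dimensions e_i), where the i-th party holds the pair (A_i, A_i°):
Z x y = W (fun i => (x i).1) (fun i => (y i).1) · Π_i ψ_i (x i).2 (y i).2. -/
def tensorInputs {n : ℕ} {d e : Fin n → ℕ}
    (W : Matrix (∀ i, Fin (d i)) (∀ i, Fin (d i)) ℂ)
    (ψ : ∀ i, Matrix (Fin (e i)) (Fin (e i)) ℂ) :
    Matrix (∀ i, Fin (d i) × Fin (e i)) (∀ i, Fin (d i) × Fin (e i)) ℂ :=
  Matrix.of fun x y =>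
    W (fun i => (x i).1) (fun i => (y i).1) * ∏ i, ψ i (x i).2 (y i).2

/-- Splitting a dependent function into pairs. -/
def splitEquiv {n : ℕ} (d e : Fin n → ℕ) :
    ((∀ i, Fin (d i)) × (∀ i, Fin (e i))) ≃ (∀ i, Fin (d i) × Fin (e i)) where
  toFun p := fun i => (p.1 i, p.2 i)
  invFun x := (fun i => (x i).1, fun i => (x i).2)
  left_inv _ := rfl
  right_inv _ := rfl

/-- The effective local effect. -/
def locEff {d e : ℕ} (P : Matrix (Fin e) (Fin e) ℂ)
    (π : Matrix (Fin d × Fin e) (Fin d × Fin e) ℂ) : Matrix (Fin d) (Fin d) ℂ :=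
  Matrix.of fun b a => ∑ s, ∑ t, P s t * π (b, t) (a, s)

theorem locEff_psd {d e : ℕ} (P : Matrix (Fin e) (Fin e) ℂ) (hP : RankOneProj P)
    (π : Matrix (Fin d × Fin e) (Fin d × Fin e) ℂ) (hπ : π.PosSemidef) :
    (locEff P π).PosSemidef := by
  obtain ⟨hH, hI, -⟩ := hP
  let V : Fin e → Matrix (Fin d × Fin e) (Fin d) ℂ := fun k =>
    Matrix.of fun p a => if p.1 = a then P p.2 k else 0
  have key : locEff P π = ∑ k, (V k)ᴴ * π * V k := by
    ext b a
    rw [Matrix.sum_apply]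
    have h1 : ∀ k, ((V k)ᴴ * π * V k) b a
        = ∑ s, ∑ t, (P s k * P k t) * π (b, t) (a, s) := by
      intro k
      simp only [Matrix.mul_apply, Matrix.conjTranspose_apply, V, Matrix.of_apply,
        Fintype.sum_prod_type]
      have hc : ∀ t, star (P t k) = P k t := fun t => hH.apply k t
      simp only [apply_ite star, hc, star_zero, ite_mul, zero_mul, mul_ite, mul_zero]
      rw [Finset.sum_comm]
      refine Finset.sum_congr rfl fun s _ => ?_
      rw [Finset.sum_ite_eq' Finset.univ a]
      simp only [Finset.mem_univ, if_true]
      rw [Finset.sum_comm]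
      simp only [Finset.sum_ite_eq', Finset.mem_univ, if_true]
      rw [Finset.sum_mul]
      refine Finset.sum_congr rfl fun t _ => ?_
      ring
    simp only [h1]
    rw [Finset.sum_comm]
    simp only [locEff, Matrix.of_apply]
    refine Finset.sum_congr rfl fun s _ => ?_
    rw [Finset.sum_comm]
    refine Finset.sum_congr rfl fun t _ => ?_
    rw [← Finset.sum_mul, ← Matrix.mul_apply, hI]
  rw [key]
  exact Matrix.posSemidef_sum _ fun k _ => hπ.conjTranspose_mul_mul_same (V k)

theorem trace_key {n : ℕ} (d e : Fin n → ℕ)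
    (W : Matrix (∀ i, Fin (d i)) (∀ i, Fin (d i)) ℂ)
    (ψ : ∀ i, Matrix (Fin (e i)) (Fin (e i)) ℂ)
    (π : ∀ i, Matrix (Fin (d i) × Fin (e i)) (Fin (d i) × Fin (e i)) ℂ) :
    (tensorInputs W ψ * prodEff π).trace
      = (W * prodEff fun i => locEff (ψ i) (π i)).trace := by
  simp only [Matrix.trace, Matrix.diag_apply, Matrix.mul_apply, tensorInputs, prodEff,
    Matrix.of_apply, locEff]
  rw [← (splitEquiv d e).sum_comp]
  simp_rw [← (splitEquiv d e).sum_comp]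
  simp only [Fintype.sum_prod_type, splitEquiv, Equiv.coe_fn_mk]
  refine Finset.sum_congr rfl fun a _ => ?_
  rw [Finset.sum_comm]
  refine Finset.sum_congr rfl fun b _ => ?_
  simp only [Finset.prod_univ_sum, Fintype.piFinset_univ, Finset.mul_sum,
    Finset.prod_mul_distrib, mul_assoc]

/-- Proposition A1: the tensor product of a multipartite-POPT state W with
rank-one projections ψ_i is again multipartite-POPT with respect to the n local pairs:
Tr[Z·E] ≥ 0 for every product effect E = ⊗_i π_i with π_i positive semidefinite. -/
theorem stmt13 (n : ℕ) (hn : 1 ≤ n) (d e : Fin n → ℕ)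
    (W : Matrix (∀ i, Fin (d i)) (∀ i, Fin (d i)) ℂ) (hW : MultiPOPT W)
    (ψ : ∀ i, Matrix (Fin (e i)) (Fin (e i)) ℂ) (hψ : ∀ i, RankOneProj (ψ i)) :
    ∀ π : ∀ i, Matrix (Fin (d i) × Fin (e i)) (Fin (d i) × Fin (e i)) ℂ,
      (∀ i, (π i).PosSemidef) →
      0 ≤ ((tensorInputs W ψ * prodEff π).trace).re ∧
      ((tensorInputs W ψ * prodEff π).trace).im = 0 := by
  intro π hπ
  rw [trace_key]
  exact hW _ fun i => locEff_psd _ (hψ i) _ (hπ i)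
end

section
/- (Proposition A2.) Fix n ≥ 1 and dimensions d₁,…,d_n. Let W be a Hermitian matrix indexed by Π_i Fin d_i that is multipartite-POPT but not positive semidefinite. Then there exists a positive semidefinite unit-trace matrix ρ indexed by Π_i Fin d_i such that the combined operator Z indexed by Π_i (Fin d_i × Fin d_i) with entries Z x y = W (fun i => (x i).1) (fun i => (y i).1) · ρ (fun i => (x i).2) (fun i => (y i).2) is NOT multipartite-POPT with respect to the n local pairs: there exist positive semidefinite matrices π_i indexed by Fin d_i × Fin d_i such that Tr[Z · E] < 0, where E x y = Π_i π_i (x i) (y i). -/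
open Matrix ComplexOrder

/-- The combined operator in which the i-th party holds both its share of W and its share
of ρ: Z x y = W (fun i => (x i).1) (fun i => (y i).1) · ρ (fun i => (x i).2) (fun i => (y i).2). -/
def combinedOp {n : ℕ} {d : Fin n → ℕ}
    (W ρ : Matrix (∀ i, Fin (d i)) (∀ i, Fin (d i)) ℂ) :
    Matrix (∀ i, Fin (d i) × Fin (d i)) (∀ i, Fin (d i) × Fin (d i)) ℂ :=
  Matrix.of fun x y =>
    W (fun i => (x i).1) (fun i => (y i).1) * ρ (fun i => (x i).2) (fun i => (y i).2)

def eDiag {n : ℕ} {d : Fin n → ℕ} (x : ∀ i, Fin (d i) × Fin (d i)) : ℂ :=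
  ∏ i, if (x i).1 = (x i).2 then 1 else 0

lemma sum_eDiag {n : ℕ} {d : Fin n → ℕ} (f : (∀ i, Fin (d i) × Fin (d i)) → ℂ) :
    ∑ x, eDiag x * f x = ∑ a : (∀ i, Fin (d i)), f (fun i => (a i, a i)) := by
  symm
  apply Fintype.sum_of_injective (fun (a : ∀ i, Fin (d i)) i => (a i, a i))
  · intro a b h
    funext i
    exact congrArg Prod.fst (congrFun h i)
  · intro x hx
    have : ∃ i, (x i).1 ≠ (x i).2 := by
      by_contra! hc
      exact hx ⟨fun i => (x i).1, funext fun i => Prod.ext rfl (hc i)⟩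
    obtain ⟨i, hi⟩ := this
    have h0 : eDiag x = 0 := Finset.prod_eq_zero (Finset.mem_univ i) (by simp [hi])
    simp [h0]
  · intro a
    simp [eDiag]

def bell (m : ℕ) : Fin m × Fin m → ℂ := fun x => if x.1 = x.2 then 1 else 0

lemma trace_bell {n : ℕ} {d : Fin n → ℕ}
    (W ρ : Matrix (∀ i, Fin (d i)) (∀ i, Fin (d i)) ℂ) :
    (combinedOp W ρ * prodEff (fun i => vecMulVec (bell (d i)) (star (bell (d i))))).trace
      = ∑ x, ∑ y, W x y * ρ x y := by
  have h : ∀ x y : (∀ i, Fin (d i) × Fin (d i)),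
      prodEff (fun i => vecMulVec (bell (d i)) (star (bell (d i)))) y x = eDiag x * eDiag y := by
    intro x y
    simp only [prodEff, eDiag, Matrix.of_apply, vecMulVec_apply, ← Finset.prod_mul_distrib]
    refine Finset.prod_congr rfl fun i _ => ?_
    simp only [bell, Pi.star_apply]
    split_ifs <;> simp
  simp only [Matrix.trace, Matrix.diag, Matrix.mul_apply, h]
  have h2 : ∀ x : (∀ i, Fin (d i) × Fin (d i)),
      ∑ y, combinedOp W ρ x y * (eDiag x * eDiag y)
       = eDiag x * ∑ y, eDiag y * combinedOp W ρ x y := by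
    intro x
    rw [Finset.mul_sum]
    exact Finset.sum_congr rfl fun y _ => by ring
  simp only [h2, sum_eDiag]
  rfl

/-- Proposition A2: for every Hermitian multipartite-POPT W that is not
positive semidefinite there is a positive semidefinite unit-trace ρ such that W ⊗ ρ is not
multipartite-POPT with respect to the n local pairs: some product effect E = ⊗_i π_i with
π_i positive semidefinite gives Tr[(W ⊗ ρ)·E] < 0. -/
theorem stmt14 (n : ℕ) (hn : 1 ≤ n) (d : Fin n → ℕ)
    (W : Matrix (∀ i, Fin (d i)) (∀ i, Fin (d i)) ℂ)
    (hHerm : W.IsHermitian) (hPOPT : MultiPOPT W) (hNotPSD : ¬ W.PosSemidef) :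
    ∃ ρ : Matrix (∀ i, Fin (d i)) (∀ i, Fin (d i)) ℂ,
      ρ.PosSemidef ∧ ρ.trace = 1 ∧
      ∃ π : ∀ i, Matrix (Fin (d i) × Fin (d i)) (Fin (d i) × Fin (d i)) ℂ,
        (∀ i, (π i).PosSemidef) ∧
        ((combinedOp W ρ * prodEff π).trace).re < 0 ∧
        ((combinedOp W ρ * prodEff π).trace).im = 0 := by
  have hv : ∃ v, ¬ 0 ≤ star v ⬝ᵥ (W *ᵥ v) := by
    by_contra! hc
    exact hNotPSD (Matrix.PosSemidef.of_dotProduct_mulVec_nonneg hHerm hc)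
  obtain ⟨v, hv⟩ := hv
  have him : (star v ⬝ᵥ (W *ᵥ v)).im = 0 := hHerm.im_star_dotProduct_mulVec_self v
  have hre : (star v ⬝ᵥ (W *ᵥ v)).re < 0 := by
    by_contra! hc
    exact hv (Complex.le_def.2 ⟨hc, him.symm⟩)
  set r : ℝ := ∑ x, ‖v x‖ ^ 2 with hr
  have hr0 : 0 < r := by
    have h0 : 0 ≤ r := Finset.sum_nonneg fun x _ => by positivity
    refine lt_of_le_of_ne h0 fun h => hv ?_
    have hz : v = 0 := by
      funext x
      have := (Finset.sum_eq_zero_iff_of_nonneg (fun x _ => by positivity)).1 (hr ▸ h.symm) x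
        (Finset.mem_univ x)
      simpa using this
    simp [hz]
  have hP : (vecMulVec (star v) v).PosSemidef := by
    simpa using posSemidef_vecMulVec_self_star (star v)
  have key : ∑ x, ∑ y, W x y * (((r⁻¹ : ℝ) : ℂ) • vecMulVec (star v) v) x y
      = ((r⁻¹ : ℝ) : ℂ) * (star v ⬝ᵥ (W *ᵥ v)) := by
    simp only [dotProduct, mulVec, Finset.mul_sum, Matrix.smul_apply, vecMulVec_apply, smul_eq_mul]
    exact Finset.sum_congr rfl fun x _ => Finset.sum_congr rfl fun y _ => by ring
  refine ⟨((r⁻¹ : ℝ) : ℂ) • vecMulVec (star v) v, hP.smul ?_, ?_,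
    fun i => vecMulVec (bell (d i)) (star (bell (d i))),
    fun i => posSemidef_vecMulVec_self_star _, ?_, ?_⟩
  · exact Complex.zero_le_real.2 (inv_nonneg.2 hr0.le)
  · have : (vecMulVec (star v) v).trace = (r : ℂ) := by
      simp only [Matrix.trace, Matrix.diag, vecMulVec_apply, hr, Complex.ofReal_sum]
      refine Finset.sum_congr rfl fun x _ => ?_
      simpa using Complex.conj_mul' (v x)
    rw [Matrix.trace_smul, this, smul_eq_mul, ← Complex.ofReal_mul, inv_mul_cancel₀ hr0.ne']
    simp
  · rw [trace_bell, key, Complex.re_ofReal_mul]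
    exact mul_neg_of_pos_of_neg (inv_pos.2 hr0) hre
  · rw [trace_bell, key, Complex.im_ofReal_mul, him, mul_zero]
end

section
/- Let σ be a positive semidefinite matrix on ℂ^d⊗ℂ^{d'} (indexed by Fin d × Fin d') whose partial trace over the first factor is a rank-one projection: the d'×d' matrix with entries Σ_{a} σ ((a,i),(a,j)) equals |ψ⟩⟨ψ| for some unit vector ψ ∈ ℂ^{d'}. Then σ factorizes as σ = τ ⊗ |ψ⟩⟨ψ|, where τ is the partial trace of σ over the second factor (the d×d matrix with entries Σ_k σ ((a,k),(b,k))); explicitly, σ ((a,i),(b,j)) = τ a b · ψ i · conj(ψ j) for all indices. -/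
open Matrix ComplexOrder

theorem aux15 {d d' : ℕ} (σ : Matrix (Fin d × Fin d') (Fin d × Fin d') ℂ)
    (hσ : σ.PosSemidef) (ψ v : Fin d' → ℂ)
    (hpt : ∀ i j : Fin d', (∑ a, σ (a, i) (a, j)) = ψ i * (starRingEnd ℂ) (ψ j))
    (hv : ∑ i, (starRingEnd ℂ) (v i) * ψ i = 0) (p : Fin d × Fin d') (b : Fin d) :
    ∑ j, σ p (b, j) * v j = 0 := by
  let x : Fin d → (Fin d × Fin d') → ℂ := fun a q => if q.1 = a then v q.2 else 0
  have hm : ∀ a q, (σ *ᵥ x a) q = ∑ j, σ q (a, j) * v j := by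
    intro a q
    simp only [x, mulVec, dotProduct, Fintype.sum_prod_type, mul_ite, mul_zero]
    rw [Finset.sum_comm]
    simp
  have hq : ∀ a, star (x a) ⬝ᵥ (σ *ᵥ x a)
      = ∑ i, ∑ j, (starRingEnd ℂ) (v i) * (σ (a, i) (a, j) * v j) := by
    intro a
    simp only [dotProduct, hm, Fintype.sum_prod_type]
    rw [Finset.sum_eq_single a]
    · simp [x, Finset.mul_sum]
    · intro c _ hc
      simp [x, hc]
    · simp
  have hs : ∑ a, star (x a) ⬝ᵥ (σ *ᵥ x a) = 0 := by
    simp only [hq]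
    rw [Finset.sum_comm]
    have : ∀ i, ∑ a, ∑ j, (starRingEnd ℂ) (v i) * (σ (a, i) (a, j) * v j)
        = ((starRingEnd ℂ) (v i) * ψ i) * ∑ j, (starRingEnd ℂ) (ψ j) * v j := by
      intro i
      rw [Finset.sum_comm, Finset.mul_sum]
      refine Finset.sum_congr rfl fun j _ => ?_
      rw [← Finset.mul_sum, ← Finset.sum_mul, hpt]
      ring
    simp only [this]
    rw [← Finset.sum_mul, hv, zero_mul]
  have h0 := (Finset.sum_eq_zero_iff_of_nonneg
    (fun a _ => hσ.dotProduct_mulVec_nonneg (x a))).1 hs b (Finset.mem_univ _)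
  have h1 := (hσ.dotProduct_mulVec_zero_iff (x b)).1 h0
  rw [← hm, h1]
  rfl

/-- if σ is positive semidefinite on ℂ^d⊗ℂ^{d'} and its partial trace over
the first factor is the rank-one projection |ψ⟩⟨ψ| onto a unit vector ψ, then σ factorizes
as σ = τ ⊗ |ψ⟩⟨ψ| where τ is the partial trace of σ over the second factor; explicitly
σ ((a,i),(b,j)) = τ a b · ψ i · conj(ψ j). -/
theorem stmt15 {d d' : ℕ} (σ : Matrix (Fin d × Fin d') (Fin d × Fin d') ℂ)
    (hσ : σ.PosSemidef) (ψ : Fin d' → ℂ)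
    (hunit : ∑ i, (starRingEnd ℂ) (ψ i) * ψ i = 1)
    (hpt : ∀ i j : Fin d', (∑ a, σ (a, i) (a, j)) = ψ i * (starRingEnd ℂ) (ψ j)) :
    ∀ (a b : Fin d) (i j : Fin d'),
      σ (a, i) (b, j) = (∑ k, σ (a, k) (b, k)) * (ψ i * (starRingEnd ℂ) (ψ j)) := by
  have key : ∀ p b j, σ p (b, j) = (starRingEnd ℂ) (ψ j) * ∑ k, σ p (b, k) * ψ k := by
    intro p b j
    have h := aux15 σ hσ ψ (fun i => (if i = j then 1 else 0) - (starRingEnd ℂ) (ψ j) * ψ i) hpt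
      (by
        simp only [map_sub, map_mul, sub_mul, Finset.sum_sub_distrib, mul_assoc,
          ← Finset.mul_sum, hunit]
        simp [apply_ite (starRingEnd ℂ)]) p b
    simp only [mul_sub, Finset.sum_sub_distrib, mul_ite, mul_one, mul_zero,
      Finset.sum_ite_eq', Finset.sum_ite_eq, Finset.mem_univ, if_true] at h
    rw [sub_eq_zero.1 h, Finset.mul_sum]
    exact Finset.sum_congr rfl fun k _ => by ring
  have herm : ∀ p q, σ p q = (starRingEnd ℂ) (σ q p) := fun p q => (hσ.1.apply p q).symm
  have key2 : ∀ a i q, σ (a, i) q = ψ i * ∑ k, σ (a, k) q * (starRingEnd ℂ) (ψ k) := by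
    intro a i q
    rw [herm, key q a i, map_mul, map_sum]
    simp only [map_mul, Complex.conj_conj, ← herm]
  have key3 : ∀ a b, ∃ c, ∀ i j, σ (a, i) (b, j) = c * (ψ i * (starRingEnd ℂ) (ψ j)) := by
    intro a b
    refine ⟨∑ k, (∑ l, σ (a, l) (b, k) * (starRingEnd ℂ) (ψ l)) * ψ k, fun i j => ?_⟩
    rw [key, Finset.sum_mul, Finset.mul_sum]
    refine Finset.sum_congr rfl fun k _ => ?_
    rw [key2 a i (b, k)]
    ring
  intro a b i j
  obtain ⟨c, hc⟩ := key3 a b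
  simp only [hc]
  rw [← Finset.mul_sum]
  simp only [mul_comm (ψ _) ((starRingEnd ℂ) (ψ _))]
  rw [hunit, mul_one]
end

section
/- Let W_p = p·Γ[|φ⁺⟩⟨φ⁺|] + (1−p)·I/4 on ℂ²⊗ℂ². For all real p, p' with 0 < p ≤ 1 and 0 ≤ p' ≤ p, there exists a finite family of 2×2 complex matrices {M_i} with Σ_i M_i† M_i = I such that W_{p'} = Σ_i (M_i ⊗ I) · W_p · (M_i ⊗ I)†. -/
open Matrix Kronecker

lemma phiPlusPT_apply (x y : Fin 2 × Fin 2) :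
    phiPlusPT x y = if x.1 = y.2 ∧ y.1 = x.2 then 1 / 2 else 0 := by
  have h : (((Real.sqrt 2)⁻¹ : ℝ) : ℂ) * (((Real.sqrt 2)⁻¹ : ℝ) : ℂ) = 1 / 2 := by
    rw [← Complex.ofReal_mul, ← mul_inv, Real.mul_self_sqrt (by norm_num)]
    norm_num
  by_cases h1 : x.1 = y.2 <;> by_cases h2 : y.1 = x.2 <;>
    simp only [phiPlusPT, phiPlusProj, phiPlus, Matrix.of_apply, h1, h2, if_true, if_false,
      Complex.conj_ofReal, h, map_zero, mul_zero, zero_mul, and_self, and_true, and_false,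
      false_and, true_and]

/-- for 0 < p ≤ 1 and 0 ≤ p' ≤ p, the state W_{p'} is obtained from W_p by a
one-sided local quantum operation: there are Kraus operators {M_i} with Σ_i M_i†M_i = I and
W_{p'} = Σ_i (M_i ⊗ I) W_p (M_i ⊗ I)†. -/
theorem stmt19 (p p' : ℝ) (hp0 : 0 < p) (hp1 : p ≤ 1) (hp'0 : 0 ≤ p') (hp'p : p' ≤ p) :
    ∃ (k : ℕ) (M : Fin k → Matrix (Fin 2) (Fin 2) ℂ),
      (∑ i, (M i)ᴴ * M i = 1) ∧
      Wp p' = ∑ i, (M i ⊗ₖ (1 : Matrix (Fin 2) (Fin 2) ℂ)) * Wp p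
          * (M i ⊗ₖ (1 : Matrix (Fin 2) (Fin 2) ℂ))ᴴ := by
  obtain ⟨q, hq0, hq1, hq⟩ : ∃ q : ℝ, 0 ≤ q ∧ q ≤ 1 ∧ p' = q * p :=
    ⟨p' / p, by positivity, (div_le_one hp0).2 hp'p, by field_simp⟩
  obtain ⟨a, ha⟩ : ∃ a : ℝ, a * a = (1 + 3 * q) / 4 :=
    ⟨_, Real.mul_self_sqrt (by linarith)⟩
  obtain ⟨b, hb⟩ : ∃ b : ℝ, b * b = (1 - q) / 4 :=
    ⟨_, Real.mul_self_sqrt (by linarith)⟩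
  have ha' : (a : ℂ) * a = (1 + 3 * q) / 4 := by exact_mod_cast congrArg Complex.ofReal ha
  have hb' : (b : ℂ) * b = (1 - q) / 4 := by exact_mod_cast congrArg Complex.ofReal hb
  subst hq
  refine ⟨4, ![!![(a : ℂ), 0; 0, a], !![(b : ℂ), 0; 0, -b], !![0, (b : ℂ); b, 0],
    !![0, (b : ℂ); -b, 0]], ?_, ?_⟩
  · ext i j
    fin_cases i <;> fin_cases j <;>
      simp [Fin.sum_univ_four, Matrix.mul_apply, Fin.sum_univ_two] <;>
      linear_combination ha' + 3 * hb'
  · ext ⟨i, j⟩ ⟨k, l⟩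
    fin_cases i <;> fin_cases j <;> fin_cases k <;> fin_cases l <;>
      simp [Fin.sum_univ_four, Matrix.mul_apply, Fin.sum_univ_two, Fintype.sum_prod_type, Wp,
        phiPlusPT_apply, Matrix.one_apply] <;> 
      grind
end
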